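/- There exists an absolute constant K>0 such that for every ψ∈𝔐_∞^+, every β∈ℝ, every convex modulus of continuity ω, and every n∈ℕ with μ(ψ;n)>2, one has |E_n(L^ψ_β H_{ω_{L₁}})_{L₁} − (2/π)·ψ(n)·e_n(ω)| ≤ K·γ_n(ψ)·ω(1/n). -/

import Mathlib

open Real MeasureTheory Filter

noncomputable section

/-- `ω` is a modulus of continuity: continuous, nondecreasing, subadditive on `[0,∞)`,
nonnegative, and `ω 0 = 0`. -/
def IsModulus (ω : ℝ → ℝ) : Prop :=
  ContinuousOn ω (Set.Ici 0) ∧ MonotoneOn ω (Set.Ici 0) ∧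
  (∀ s t : ℝ, 0 ≤ s → 0 ≤ t → ω (s + t) ≤ ω s + ω t) ∧ ω 0 = 0 ∧
  ∀ t : ℝ, 0 ≤ t → 0 ≤ ω t

/-- `ψ` belongs to `𝔐_∞^+`, where `η t = ψ⁻¹(ψ t / 2)` (i.e. `η t ≥ t` and
`ψ (η t) = ψ t / 2`) and `μ t = t / (η t − t)` is nondecreasing and tends to `∞`. -/
def IsMInfPlus (ψ η : ℝ → ℝ) : Prop :=
  (∀ t ≥ (1:ℝ), 0 < ψ t) ∧ ContinuousOn ψ (Set.Ici 1) ∧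
  ConvexOn ℝ (Set.Ici 1) ψ ∧ Tendsto ψ atTop (nhds 0) ∧
  (∀ t ≥ (1:ℝ), t < η t ∧ ψ (η t) = ψ t / 2) ∧
  MonotoneOn (fun t => t / (η t - t)) (Set.Ici 1) ∧
  Tendsto (fun t => t / (η t - t)) atTop atTop

/-- `T` is a trigonometric polynomial of degree at most `n − 1`. -/
def IsTrigPoly (n : ℕ) (T : ℝ → ℝ) : Prop :=
  ∃ a b : ℕ → ℝ,
    ∀ x, T x = ∑ k ∈ Finset.range n, (a k * Real.cos (k * x) + b k * Real.sin (k * x))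

/-- The kernel `Ψ_β(t) = ∑_{k=1}^∞ ψ(k) cos(kt − βπ/2)`. -/
def PsiKer (ψ : ℝ → ℝ) (β : ℝ) (t : ℝ) : ℝ :=
  ∑' k : ℕ, ψ (k + 1) * Real.cos ((k + 1) * t - β * π / 2)

/-- The class `L^ψ_β H_{ω_{L₁}}`. -/
def L1Class (ψ : ℝ → ℝ) (β : ℝ) (ω : ℝ → ℝ) : Set (ℝ → ℝ) :=
  {f | IntervalIntegrable f volume (-π) π ∧ Function.Periodic f (2 * π) ∧
    ∃ a₀ : ℝ, ∃ φ : ℝ → ℝ, IntervalIntegrable φ volume (-π) π ∧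
      Function.Periodic φ (2 * π) ∧
      (∫ t in (-π)..π, φ t) = 0 ∧
      (∀ t : ℝ, 0 ≤ t → ∀ h : ℝ, |h| ≤ t →
        (∫ x in (-π)..π, |φ (x + h) - φ x|) ≤ ω t) ∧
      ∀ᵐ x : ℝ, f x = a₀ / 2 + (1 / π) * ∫ t in (-π)..π, φ (x - t) * PsiKer ψ β t}

/-- Best `L₁` approximation of `f` by trigonometric polynomials of degree `≤ n − 1`. -/
def EnL1 (n : ℕ) (f : ℝ → ℝ) : ℝ :=
  sInf {e | ∃ T : ℝ → ℝ, IsTrigPoly n T ∧ e = ∫ x in (-π)..π, |f x - T x|}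

/-- Best `L₁` approximation of a class of functions. -/
def EnL1Class (n : ℕ) (N : Set (ℝ → ℝ)) : ℝ := sSup (EnL1 n '' N)

/-- `e_n(ω) = ∫_0^{π/2} ω(2t/n) sin t dt`. -/
def eN (n : ℕ) (ω : ℝ → ℝ) : ℝ := ∫ t in (0:ℝ)..(π / 2), ω (2 * t / n) * Real.sin t

/-- `γ_n(ψ) = ψ(n+1)(1/n + 1/(μ(n)−2)) + ψ(3n)(1 + ln⁺(η(n)−n))`. -/
def gammaN (ψ η : ℝ → ℝ) (n : ℕ) : ℝ :=
  ψ (n + 1) * (1 / n + 1 / ((n : ℝ) / (η n - n) - 2)) +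
    ψ (3 * n) * (1 + max 0 (Real.log (η n - n)))

/-- For convex moduli of continuity,
`E_n(L^ψ_β H_{ω_{L₁}})_{L₁} = (2/π) ψ(n) e_n(ω) + O(1) γ_n(ψ) ω(1/n)` whenever `μ(n) > 2`. -/

lemma psi_anti {ψ η : ℝ → ℝ} (h : IsMInfPlus ψ η) : AntitoneOn ψ (Set.Ici 1) := by
  obtain ⟨hpos, hc, hconv, hlim, -⟩ := h
  intro s hs t ht hst
  rcases hst.eq_or_lt with rfl | hlt
  · exact le_rfl
  have h1 : Tendsto (fun u : ℝ => ψ s + ψ u) atTop (nhds (ψ s + 0)) := tendsto_const_nhds.add hlim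
  rw [add_zero] at h1
  refine ge_of_tendsto h1 ?_
  filter_upwards [eventually_gt_atTop t] with u hu
  have hu1 : (1:ℝ) ≤ u := le_trans ht hu.le
  have hd : 0 < u - s := by linarith
  have b1 : 0 ≤ (u - t)/(u-s) := by apply div_nonneg <;> linarith
  have b2 : 0 ≤ (t - s)/(u-s) := by apply div_nonneg <;> linarith
  have b3 : (u - t)/(u-s) + (t - s)/(u-s) = 1 := by field_simp; ring
  have := hconv.2 hs (show u ∈ Set.Ici (1:ℝ) from hu1) b1 b2 b3
  have e : ((u - t)/(u-s)) • s + ((t-s)/(u-s)) • u = t := by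
    simp only [smul_eq_mul]; field_simp; ring
  rw [e] at this
  simp only [smul_eq_mul] at this
  have a1 : (u - t)/(u-s) ≤ 1 := by rw [div_le_one hd]; linarith
  have a2 : (t - s)/(u-s) ≤ 1 := by rw [div_le_one hd]; linarith
  have p1 := hpos s hs
  have p2 := hpos u hu1
  nlinarith

lemma psi_half {ψ η : ℝ → ℝ} (h : IsMInfPlus ψ η) {N q : ℝ} (hN : 1 ≤ N)
    (hq : N / (η N - N) ≥ 1 / (q - 1)) (hq1 : 1 < q) {t : ℝ} (ht : N ≤ t) : ψ (q * t) ≤ ψ t / 2 := by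
  have ha := psi_anti h
  obtain ⟨hpos, hc, hconv, hlim, heta, hmono, -⟩ := h
  have ht1 : (1:ℝ) ≤ t := hN.trans ht
  obtain ⟨e1, e2⟩ := heta t ht1
  have m := hmono (show N ∈ Set.Ici (1:ℝ) from hN) (show t ∈ Set.Ici (1:ℝ) from ht1) ht
  simp only at m
  have m2 : 1 / (q - 1) ≤ t / (η t - t) := le_trans hq m
  rw [div_le_div_iff₀ (by linarith) (by linarith)] at m2
  rw [← e2]
  apply ha (show η t ∈ Set.Ici (1:ℝ) from by simp only [Set.mem_Ici]; linarith)
  · simp only [Set.mem_Ici]; nlinarith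
  · nlinarith

lemma psi_decay {ψ η : ℝ → ℝ} (h : IsMInfPlus ψ η) : ∃ C, 0 < C ∧ ∀ t ≥ (1:ℝ), ψ t * t ^ 4 ≤ C := by
  have ha := psi_anti h
  have hpos := h.1
  obtain ⟨t1, ht1⟩ := (h.2.2.2.2.2.2.eventually_ge_atTop 6).exists_forall_of_atTop
  set t0 := max t1 1 with ht0
  have ht01 : 1 ≤ t0 := le_max_right _ _
  have hhalf : ∀ t ≥ t0, ψ (7/6 * t) ≤ ψ t / 2 := fun t ht =>
    psi_half h ht01 (by have := ht1 t0 (le_max_left _ _); norm_num; linarith) (by norm_num) ht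
  have key : ∀ i : ℕ, ∀ t, t0 ≤ t → t ≤ t0 * (7/6)^(i+1) → ψ t * t^4 ≤ ψ t0 * (7/6*t0)^4 := by
    have base : ∀ t, t0 ≤ t → t ≤ 7/6*t0 → ψ t * t^4 ≤ ψ t0 * (7/6*t0)^4 := by
      intro t h1 h2
      have := ha (show t0 ∈ Set.Ici (1:ℝ) from ht01) (show t ∈ Set.Ici (1:ℝ) from ht01.trans h1) h1
      have := hpos t0 ht01
      have : 0 ≤ t := by linarith
      gcongr
    intro i
    induction i with
    | zero => intro t h1 h2; exact base t h1 (by linarith)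
    | succ i ih =>
      intro t h1 h2
      by_cases hb : t ≤ 7/6*t0
      · exact base t h1 hb
      push Not at hb
      have i1 := ih (6/7*t) (by linarith) (by rw [pow_succ] at h2; linarith)
      have i2 := hhalf (6/7*t) (by linarith)
      rw [show 7/6*(6/7*t) = t by ring] at i2
      have p := hpos (6/7*t) (by linarith)
      have t4 : 0 ≤ t^4 := by positivity
      have e : ψ (6/7*t) * (6/7*t)^4 = (6/7)^4 * (ψ (6/7*t) * t^4) := by ring
      rw [e] at i1
      have : ψ t * t^4 ≤ ψ (6/7*t) / 2 * t^4 := by gcongr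
      have : 0 ≤ ψ (6/7*t) * t^4 := by positivity
      nlinarith
  refine ⟨ψ t0 * (7/6*t0)^4 + ψ 1 * t0^4, ?_, ?_⟩
  · have := hpos t0 ht01
    have := hpos 1 le_rfl
    positivity
  intro t ht
  have p0 := hpos t0 ht01
  have p1 := hpos 1 le_rfl
  by_cases hb : t0 ≤ t
  · obtain ⟨i, hi⟩ := pow_unbounded_of_one_lt (t / t0) (show (1:ℝ) < 7/6 by norm_num)
    have : ψ t * t^4 ≤ ψ t0 * (7/6*t0)^4 := by
      refine key i t hb ?_
      rw [div_lt_iff₀ (by linarith)] at hi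
      have : (0:ℝ) < (7/6)^i := by positivity
      rw [pow_succ]; nlinarith
    have : 0 ≤ ψ 1 * t0^4 := by positivity
    linarith
  · push Not at hb
    have := ha (show (1:ℝ) ∈ Set.Ici (1:ℝ) from Set.mem_Ici.2 le_rfl) (show t ∈ Set.Ici (1:ℝ) from ht) ht
    have h0 : 0 ≤ t := by linarith
    have : ψ t * t^4 ≤ ψ 1 * t0^4 := by gcongr
    have : 0 ≤ ψ t0 * (7/6*t0)^4 := by positivity
    linarith

lemma psi_integrable {ψ η : ℝ → ℝ} (h : IsMInfPlus ψ η) {N : ℝ} (hN : 1 ≤ N) :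
    IntegrableOn ψ (Set.Ioi N) := by
  obtain ⟨C, hC, hd⟩ := psi_decay h
  have hi : IntegrableOn (fun t : ℝ => C * t ^ (-4:ℝ)) (Set.Ioi N) :=
    (integrableOn_Ioi_rpow_of_lt (by norm_num) (by linarith)).const_mul C
  refine Integrable.mono' hi ?_ ?_
  · exact (h.2.1.mono (fun x hx => le_trans hN (le_of_lt hx))).aestronglyMeasurable measurableSet_Ioi
  · refine (ae_restrict_iff' measurableSet_Ioi).2 (ae_of_all _ fun t ht => ?_)
    have ht1 : (1:ℝ) ≤ t := hN.trans (le_of_lt ht)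
    have t0 : 0 < t := by linarith
    rw [Real.norm_of_nonneg (h.1 t ht1).le, show (-4:ℝ) = -((4:ℕ):ℝ) by norm_num, Real.rpow_neg t0.le,
      Real.rpow_natCast, ← div_eq_mul_inv, le_div_iff₀ (by positivity)]
    exact hd t ht1

lemma psi_int_bound {ψ η : ℝ → ℝ} (h : IsMInfPlus ψ η) {N : ℝ} (hN : 1 ≤ N)
    (hm : 2 ≤ N / (η N - N)) : ∫ t in Set.Ioi N, ψ t ≤ 4 * ψ N * (η N - N) := by
  have hn := (h.2.2.2.2.1 N hN).1
  set q := η N / N with hq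
  have hN0 : 0 < N := by linarith
  have hq1 : 1 < q := by rw [hq, lt_div_iff₀ hN0]; linarith
  have hqN : q * N = η N := by rw [hq]; field_simp
  have hq2 : q ≤ 3/2 := by
    rw [le_div_iff₀ (by linarith)] at hm
    rw [hq, div_le_iff₀ hN0]; linarith
  have hhalf : ∀ t ≥ N, ψ (q * t) ≤ ψ t / 2 := fun t ht => by
    refine psi_half h hN ?_ hq1 ht
    rw [ge_iff_le, div_le_div_iff₀ (by linarith) (by linarith)]; linarith
  have hI := psi_integrable h hN
  have hI2 := psi_integrable h (show 1 ≤ η N by linarith)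
  have hsub : ∫ t in Set.Ioi N, ψ (q * t) = q⁻¹ * ∫ t in Set.Ioi (η N), ψ t := by
    have := MeasureTheory.integral_comp_mul_left_Ioi ψ N (show 0 < q by linarith)
    rw [hqN] at this; simpa using this
  have hle : ∫ t in Set.Ioi N, ψ (q * t) ≤ ∫ t in Set.Ioi N, ψ t / 2 := by
    refine setIntegral_mono_on ?_ (hI.div_const 2) measurableSet_Ioi (fun t ht => hhalf t (le_of_lt ht))
    rw [integrableOn_Ioi_comp_mul_left_iff _ _ (show 0 < q by linarith), hqN]; exact hI2
  rw [hsub, integral_div] at hle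
  have hsplit : ∫ t in Set.Ioi N, ψ t = (∫ t in Set.Ioc N (η N), ψ t) + ∫ t in Set.Ioi (η N), ψ t := by
    rw [← setIntegral_union (Set.Ioc_disjoint_Ioi le_rfl) measurableSet_Ioi
      (hI.mono_set Set.Ioc_subset_Ioi_self) hI2, Set.Ioc_union_Ioi_eq_Ioi hn.le]
  have hfirst : ∫ t in Set.Ioc N (η N), ψ t ≤ ψ N * (η N - N) := by
    have : ∫ t in Set.Ioc N (η N), ψ t ≤ ∫ t in Set.Ioc N (η N), ψ N := by
      refine setIntegral_mono_on (hI.mono_set Set.Ioc_subset_Ioi_self) (by simp) measurableSet_Ioc ?_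
      intro t ht
      exact psi_anti h (show N ∈ Set.Ici (1:ℝ) from hN)
        (show t ∈ Set.Ici (1:ℝ) from hN.trans ht.1.le) ht.1.le
    refine this.trans (le_of_eq ?_)
    rw [setIntegral_const, smul_eq_mul, Measure.real, Real.volume_Ioc, ENNReal.toReal_ofReal (by linarith)]
    ring
  have hpos : 0 ≤ ∫ t in Set.Ioi N, ψ t :=
    setIntegral_nonneg measurableSet_Ioi fun t ht => (h.1 t (hN.trans (le_of_lt ht))).le
  set I := ∫ t in Set.Ioi N, ψ t
  set J := ∫ t in Set.Ioi (η N), ψ t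
  have : J ≤ q * (I / 2) := by
    rw [inv_mul_le_iff₀ (by linarith)] at hle; exact hle
  nlinarith

lemma psi_summable {ψ η : ℝ → ℝ} (h : IsMInfPlus ψ η) {N : ℕ} (hN : 1 ≤ N) :
    Summable (fun k : ℕ => ψ ((N:ℝ) + k) * ((k:ℝ)+1)^2) := by
  obtain ⟨C, hC, hd⟩ := psi_decay h
  have hs : Summable (fun k : ℕ => C * (1 / ((k:ℝ)+1)^2)) := by
    have := (summable_nat_add_iff 1).2 (Real.summable_one_div_nat_pow.2 (show 1 < 2 by norm_num))
    refine (this.congr ?_).mul_left C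
    intro k; push_cast; rfl
  have hN' : (1:ℝ) ≤ N := by exact_mod_cast hN
  refine Summable.of_nonneg_of_le (fun k => ?_) (fun k => ?_) hs
  · have := h.1 ((N:ℝ)+k) (by linarith [k.cast_nonneg (α := ℝ)])
    positivity
  · have k0 : (0:ℝ) ≤ k := k.cast_nonneg
    have p := h.1 ((N:ℝ)+k) (by linarith)
    have := hd ((N:ℝ)+k) (by linarith)
    rw [mul_one_div, le_div_iff₀ (by positivity)]
    have e : ((k:ℝ)+1)^4 ≤ ((N:ℝ)+k)^4 := pow_le_pow_left₀ (by positivity) (by linarith) 4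
    calc _ = ψ ((N:ℝ) + k) * ((k:ℝ)+1)^4 := by ring
      _ ≤ ψ ((N:ℝ) + k) * ((N:ℝ)+k)^4 := by gcongr
      _ ≤ C := this

lemma psi_summable0 {ψ η : ℝ → ℝ} (h : IsMInfPlus ψ η) {N : ℕ} (hN : 1 ≤ N) :
    Summable (fun k : ℕ => ψ ((N:ℝ) + k)) := by
  have hN' : (1:ℝ) ≤ N := by exact_mod_cast hN
  refine Summable.of_nonneg_of_le (fun k => ?_) (fun k => ?_) (psi_summable h hN)
  · exact (h.1 ((N:ℝ)+k) (by linarith [k.cast_nonneg (α := ℝ)])).le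
  · have k0 : (0:ℝ) ≤ k := k.cast_nonneg
    have p := h.1 ((N:ℝ)+k) (by linarith)
    have : (1:ℝ) ≤ ((k:ℝ)+1)^2 := by nlinarith
    nlinarith

/-- sum of `ψ(k)` over `k ≥ N`. -/
lemma psi_sum_bound {ψ η : ℝ → ℝ} (h : IsMInfPlus ψ η) {n N : ℕ} (hn : 1 ≤ n) (hN : n ≤ N)
    (hm : 2 ≤ (n:ℝ) / (η n - n)) :
    ∑' k : ℕ, ψ ((N:ℝ) + k) ≤ ψ N * (1 + 4 * (N / n) * (η n - n)) := by
  have hn' : (1:ℝ) ≤ n := by exact_mod_cast hn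
  have hN' : (n:ℝ) ≤ N := by exact_mod_cast hN
  have hN1 : (1:ℝ) ≤ N := hn'.trans hN'
  have a1 := (h.2.2.2.2.1 n hn').1
  have a2 := (h.2.2.2.2.1 N hN1).1
  have hmono := h.2.2.2.2.2.1 (show (n:ℝ) ∈ Set.Ici (1:ℝ) from hn')
    (show (N:ℝ) ∈ Set.Ici (1:ℝ) from hN1) hN'
  simp only at hmono
  rw [(psi_summable0 h (hn.trans hN)).tsum_eq_zero_add]
  have anti : AntitoneOn ψ (Set.Ici (N:ℝ)) := (psi_anti h).mono (Set.Ici_subset_Ici.2 hN1)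
  have t := AntitoneOn.tsum_comp_add_le_integral (f := ψ) (N := N) anti
    (psi_integrable h hN1) (fun t ht => (h.1 t (hN1.trans (le_of_lt ht))).le)
  have b := psi_int_bound h hN1 (hm.trans hmono)
  have c : η N - N ≤ N / n * (η n - n) := by
    rw [div_le_div_iff₀ (by linarith) (by linarith)] at hmono
    rw [div_mul_eq_mul_div, le_div_iff₀ (by linarith)]; linarith
  have e : ∑' k : ℕ, ψ ((N:ℝ) + ((k+1 : ℕ):ℝ)) = ∑' k : ℕ, ψ ((N + 1 + k : ℕ):ℝ) := by
    congr 1; ext k; congr 1; push_cast; ring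
  rw [e]
  have p := h.1 N hN1
  simp only [Nat.cast_zero, add_zero]
  have : 4 * ψ N * (η N - N) ≤ 4 * ψ N * (N / n * (η n - n)) := by gcongr
  simp only [Nat.cast_add, Nat.cast_one] at t ⊢
  have t' : ∑' k : ℕ, ψ ((N:ℝ) + 1 + k) ≤ ∫ t in Set.Ioi (N:ℝ), ψ t := by
    convert t using 3; ring_nf
  linarith

def PerL1 (φ : ℝ → ℝ) : Prop := IntervalIntegrable φ volume (-π) π ∧ Function.Periodic φ (2 * π)

def norm1 (φ : ℝ → ℝ) : ℝ := ∫ x in (-π)..π, |φ x|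

lemma norm1_nonneg (φ : ℝ → ℝ) : 0 ≤ norm1 φ :=
  intervalIntegral.integral_nonneg (by linarith [pi_pos]) fun _ _ => abs_nonneg _

lemma per_int {g : ℝ → ℝ} (h : Function.Periodic g (2*π)) (a : ℝ) :
    ∫ x in a..(a + 2*π), g x = ∫ x in (-π)..π, g x := by
  have := h.intervalIntegral_add_eq a (-π)
  rw [this]; congr 1; ring

lemma per_shift {g : ℝ → ℝ} (h : Function.Periodic g (2*π)) (c : ℝ) :
    ∫ x in (-π)..π, g (x + c) = ∫ x in (-π)..π, g x := by
  rw [intervalIntegral.integral_comp_add_right, ← per_int h (-π + c)]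
  congr 1; ring

lemma per_refl {g : ℝ → ℝ} (h : Function.Periodic g (2*π)) (c : ℝ) :
    ∫ x in (-π)..π, g (c - x) = ∫ x in (-π)..π, g x := by
  rw [intervalIntegral.integral_comp_sub_left, ← per_int h (c - π)]
  congr 1 <;> ring

namespace PerL1
variable {φ : ℝ → ℝ}

lemma ii (h : PerL1 φ) (a b : ℝ) : IntervalIntegrable φ volume a b := by
  refine h.2.intervalIntegrable (t := -π) (by positivity) ?_ a b
  convert h.1 using 1; ring

lemma aesm (h : PerL1 φ) : AEStronglyMeasurable φ volume := by
  have : LocallyIntegrable φ volume := by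
    rw [locallyIntegrable_iff]
    intro K hK
    obtain ⟨R, hR⟩ := hK.isBounded.subset_closedBall 0
    have := (h.ii (-|R|-1) (|R|+1))
    rw [intervalIntegrable_iff_integrableOn_Ioc_of_le (by linarith [abs_nonneg R])] at this
    refine this.mono_set (hR.trans fun x hx => ?_)
    rw [Metric.mem_closedBall, Real.dist_eq, sub_zero] at hx
    have := abs_le.1 (hx.trans (le_abs_self R))
    constructor <;> linarith
  exact this.aestronglyMeasurable

lemma abs (h : PerL1 φ) : PerL1 (fun x => |φ x|) :=
  ⟨h.1.abs, fun x => by simp only [h.2 x]⟩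

lemma add_arg (h : PerL1 φ) (c : ℝ) : PerL1 (fun x => φ (x + c)) := by
  refine ⟨?_, fun x => ?_⟩
  · have := (h.ii (-π + c) (π + c)).comp_add_right c
    simpa using this
  · show φ (x + 2*π + c) = φ (x + c)
    rw [← h.2 (x + c)]; ring_nf

lemma refl_arg (h : PerL1 φ) (c : ℝ) : PerL1 (fun x => φ (c - x)) := by
  refine ⟨?_, fun x => ?_⟩
  · have := (h.ii (c+π) (c-π)).comp_sub_left c
    simpa using this
  · show φ (c - (x + 2*π)) = φ (c - x)
    rw [← h.2 (c - (x+2*π))]; ring_nf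

lemma sub (h : PerL1 φ) {χ : ℝ → ℝ} (h' : PerL1 χ) : PerL1 (fun x => φ x - χ x) :=
  ⟨h.1.sub h'.1, fun x => by simp only [h.2 x, h'.2 x]⟩

lemma of_cont (hc : Continuous φ) (hp : Function.Periodic φ (2*π)) : PerL1 φ :=
  ⟨hc.intervalIntegrable _ _, hp⟩

lemma norm_shift (h : PerL1 φ) (c : ℝ) : ∫ x in (-π)..π, |φ (x + c)| = norm1 φ :=
  per_shift h.abs.2 c

lemma mul_cont (h : PerL1 φ) {q : ℝ → ℝ} (hq : Continuous q) (a b x : ℝ) :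
    IntervalIntegrable (fun t => φ (x - t) * q t) volume a b :=
  ((h.refl_arg x).ii a b).mul_continuousOn hq.continuousOn

end PerL1

/-- Minkowski's inequality for interval integrals -/
lemma minkowski {F : ℝ × ℝ → ℝ} {W : ℝ → ℝ} {a b : ℝ} (hab : a ≤ b)
    (hF : Integrable F ((volume.restrict (Set.Ioc (-π) π)).prod (volume.restrict (Set.Ioc a b))))
    (hW : IntervalIntegrable W volume a b)
    (hb : ∀ t ∈ Set.Ioc a b, ∫ x in (-π)..π, |F (x, t)| ≤ W t) :
    IntervalIntegrable (fun x => ∫ t in a..b, F (x, t)) volume (-π) π ∧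
    ∫ x in (-π)..π, |∫ t in a..b, F (x, t)| ≤ ∫ t in a..b, W t := by
  have hpi : -π ≤ π := by linarith [pi_pos]
  have i1 : Integrable (fun x => ∫ t in a..b, F (x, t)) (volume.restrict (Set.Ioc (-π) π)) := by
    simp only [intervalIntegral.integral_of_le hab]
    exact hF.integral_prod_left
  have i2 : Integrable (fun x => ∫ t in a..b, |F (x, t)|) (volume.restrict (Set.Ioc (-π) π)) := by
    simp only [intervalIntegral.integral_of_le hab]
    exact hF.abs.integral_prod_left
  refine ⟨(intervalIntegrable_iff_integrableOn_Ioc_of_le hpi).2 i1, ?_⟩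
  rw [intervalIntegral.integral_of_le hpi]
  calc ∫ x in Set.Ioc (-π) π, |∫ t in a..b, F (x, t)|
      ≤ ∫ x in Set.Ioc (-π) π, ∫ t in a..b, |F (x, t)| :=
        integral_mono i1.abs i2 (fun x => intervalIntegral.abs_integral_le_integral_abs hab)
    _ = ∫ t in Set.Ioc a b, ∫ x in Set.Ioc (-π) π, |F (x, t)| := by
        simp only [intervalIntegral.integral_of_le hab]
        exact integral_integral_swap hF.abs
    _ ≤ ∫ t in a..b, W t := by
        rw [intervalIntegral.integral_of_le hab]
        refine setIntegral_mono_on hF.abs.integral_prod_right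
          ((intervalIntegrable_iff_integrableOn_Ioc_of_le hab).1 hW) measurableSet_Ioc ?_
        intro t ht
        have := hb t ht
        rwa [intervalIntegral.integral_of_le hpi] at this

lemma prod_int_aux {φ q : ℝ → ℝ} (h : PerL1 φ) (hq : Continuous q) {a b : ℝ}
    (T : ℝ → ℝ) (τ : ℝ × ℝ → ℝ) (hτ : ∀ p, τ p = p.1 + T p.2)
    (hqm : Measure.QuasiMeasurePreserving τ (volume.prod volume) volume) :
    Integrable (fun p : ℝ × ℝ => φ (τ p) * q p.2)
      ((volume.restrict (Set.Ioc (-π) π)).prod (volume.restrict (Set.Ioc a b))) := by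
  have hpi : -π ≤ π := by linarith [pi_pos]
  have m : AEStronglyMeasurable (fun p : ℝ × ℝ => φ (τ p) * q p.2)
      ((volume.restrict (Set.Ioc (-π) π)).prod (volume.restrict (Set.Ioc a b))) := by
    have : AEStronglyMeasurable (fun p : ℝ × ℝ => φ (τ p) * q p.2) (volume.prod volume) :=
      (h.aesm.comp_quasiMeasurePreserving hqm).mul
        (hq.comp continuous_snd).aestronglyMeasurable
    rw [Measure.prod_restrict]
    exact this.restrict
  have e : ∀ t, ∫ x in Set.Ioc (-π) π, ‖φ (τ (x, t)) * q t‖ = norm1 φ * |q t| := by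
    intro t
    simp only [norm_mul, Real.norm_eq_abs, hτ]
    rw [integral_mul_const, ← intervalIntegral.integral_of_le hpi, h.norm_shift]
  rw [integrable_prod_iff' m]
  constructor
  · refine ae_of_all _ fun t => ?_
    simp only [hτ]
    exact ((intervalIntegrable_iff_integrableOn_Ioc_of_le hpi).1 (h.add_arg (T t)).1).mul_const _
  · simp only [e]
    have : Continuous fun t => norm1 φ * |q t| := by fun_prop
    exact this.integrableOn_Ioc

lemma prod_int_sub {φ q : ℝ → ℝ} (h : PerL1 φ) (hq : Continuous q) (c a b : ℝ) :
    Integrable (fun p : ℝ × ℝ => φ (p.1 - c - p.2) * q p.2)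
      ((volume.restrict (Set.Ioc (-π) π)).prod (volume.restrict (Set.Ioc a b))) := by
  have := prod_int_aux (h.add_arg (-c)) hq (a := a) (b := b) (fun t => -t) (fun p => p.1 - p.2)
    (fun p => by ring) (quasiMeasurePreserving_sub volume volume)
  convert this using 4; ring

lemma prod_int_add {φ q : ℝ → ℝ} (h : PerL1 φ) (hq : Continuous q) (c a b : ℝ) :
    Integrable (fun p : ℝ × ℝ => φ (p.1 - c + p.2) * q p.2)
      ((volume.restrict (Set.Ioc (-π) π)).prod (volume.restrict (Set.Ioc a b))) := by
  have := prod_int_aux (h.add_arg (-c)) hq (a := a) (b := b) (fun t => t) (fun p => p.1 + p.2)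
    (fun p => by ring) (quasiMeasurePreserving_add volume volume)
  convert this using 4; ring

lemma young {φ q : ℝ → ℝ} (h : PerL1 φ) (hq : Continuous q) {a b : ℝ} (hab : a ≤ b) :
    IntervalIntegrable (fun x => ∫ t in a..b, φ (x - t) * q t) volume (-π) π ∧
    ∫ x in (-π)..π, |∫ t in a..b, φ (x - t) * q t| ≤ norm1 φ * ∫ t in a..b, |q t| := by
  have hF := prod_int_sub h hq 0 a b
  simp only [sub_zero] at hF
  have := minkowski (W := fun t => norm1 φ * |q t|) hab hF
    (Continuous.intervalIntegrable (by fun_prop) _ _) (fun t _ => by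
      simp only [abs_mul, intervalIntegral.integral_mul_const]
      have := h.norm_shift (-t)
      simp only [← sub_eq_add_neg] at this
      rw [this])
  simpa only [intervalIntegral.integral_const_mul] using this

lemma young_diff {φ q W : ℝ → ℝ} (h : PerL1 φ) (hq : Continuous q) {b : ℝ} (hb : 0 ≤ b) (c : ℝ)
    (hq0 : ∀ t ∈ Set.Ioc 0 b, 0 ≤ q t) (hWc : Continuous W)
    (hW : ∀ t, 0 ≤ t → ∫ x in (-π)..π, |φ (x + t) - φ x| ≤ W t) :
    IntervalIntegrable (fun x => ∫ t in (0:ℝ)..b, (φ (x - c - t) - φ (x - c + t)) * q t)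
      volume (-π) π ∧
    ∫ x in (-π)..π, |∫ t in (0:ℝ)..b, (φ (x - c - t) - φ (x - c + t)) * q t| ≤
      ∫ t in (0:ℝ)..b, W (2 * t) * q t := by
  have hF : Integrable (fun p : ℝ × ℝ => (φ (p.1 - c - p.2) - φ (p.1 - c + p.2)) * q p.2)
      ((volume.restrict (Set.Ioc (-π) π)).prod (volume.restrict (Set.Ioc 0 b))) := by
    have := (prod_int_sub h hq c 0 b).sub (prod_int_add h hq c 0 b)
    convert this using 2
    simp only [Pi.sub_apply]; ring
  refine minkowski (W := fun t => W (2*t) * q t) hb hF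
    (Continuous.intervalIntegrable (by fun_prop) _ _) (fun t ht => ?_)
  simp only [abs_mul, intervalIntegral.integral_mul_const, abs_of_nonneg (hq0 t ht)]
  refine mul_le_mul_of_nonneg_right ?_ (hq0 t ht)
  have hp : Function.Periodic (fun x => |φ (x + 2*t) - φ x|) (2*π) := fun x => by
    simp only [h.2 x, show x + 2*π + 2*t = x + 2*t + 2*π by ring, h.2 (x + 2*t)]
  have := per_shift hp (-c - t)
  refine le_trans (le_of_eq ?_) (hW (2*t) (by linarith [ht.1]))
  rw [← this]
  refine intervalIntegral.integral_congr fun x _ => ?_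
  show _ = |φ (x + (-c - t) + 2 * t) - φ (x + (-c - t))|
  rw [abs_sub_comm]; congr 2 <;> ring_nf


namespace IsTrigPoly
variable {n : ℕ}

lemma add {S T : ℝ → ℝ} (hS : IsTrigPoly n S) (hT : IsTrigPoly n T) :
    IsTrigPoly n (fun x => S x + T x) := by
  obtain ⟨a, b, h⟩ := hS
  obtain ⟨a', b', h'⟩ := hT
  refine ⟨fun k => a k + a' k, fun k => b k + b' k, fun x => ?_⟩
  simp only [h, h', ← Finset.sum_add_distrib]
  refine Finset.sum_congr rfl fun k _ => by ring

lemma cmul {S : ℝ → ℝ} (hS : IsTrigPoly n S) (c : ℝ) : IsTrigPoly n (fun x => c * S x) := by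
  obtain ⟨a, b, h⟩ := hS
  refine ⟨fun k => c * a k, fun k => c * b k, fun x => ?_⟩
  simp only [h, Finset.mul_sum]
  refine Finset.sum_congr rfl fun k _ => by ring

lemma sub {S T : ℝ → ℝ} (hS : IsTrigPoly n S) (hT : IsTrigPoly n T) :
    IsTrigPoly n (fun x => S x - T x) := by
  have := hS.add (hT.cmul (-1))
  convert this using 2; ring

lemma zero : IsTrigPoly n (fun _ => 0) := ⟨0, 0, fun x => by simp⟩

lemma sum {ι : Type*} (s : Finset ι) {S : ι → ℝ → ℝ} (h : ∀ i ∈ s, IsTrigPoly n (S i)) :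
    IsTrigPoly n (fun x => ∑ i ∈ s, S i x) := by
  classical
  induction s using Finset.induction_on with
  | empty => simpa using zero
  | insert i s hi ih =>
    simp only [Finset.sum_insert hi]
    exact (h i (by simp)).add (ih fun j hj => h j (by simp [hj]))

lemma cos {k : ℕ} (hk : k < n) (α : ℝ) : IsTrigPoly n (fun x => Real.cos (k * x + α)) := by
  refine ⟨Pi.single k (Real.cos α), Pi.single k (-Real.sin α), fun x => ?_⟩
  rw [Finset.sum_eq_single k]
  · simp [Real.cos_add]; ring
  · intro j _ hj; simp [hj]
  · intro h; simp at h; omega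

lemma const (hn : 1 ≤ n) (c : ℝ) : IsTrigPoly n (fun _ => c) := by
  have := (cos (n := n) (k := 0) (by omega) 0).cmul c
  simpa using this

lemma cos_int {k : ℤ} (hk : |k| < n) (α : ℝ) : IsTrigPoly n (fun x => Real.cos (k * x + α)) := by
  obtain ⟨m, rfl | rfl⟩ := k.eq_nat_or_neg
  · simpa using cos (n := n) (k := m) (by simpa using hk) α
  · have := cos (n := n) (k := m) (by simpa using hk) (-α)
    convert this using 2
    rw [← Real.cos_neg]; push_cast; ring_nf

lemma continuous {T : ℝ → ℝ} (h : IsTrigPoly n T) : Continuous T := by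
  obtain ⟨a, b, h⟩ := h
  rw [show T = _ from funext h]; fun_prop

lemma periodic {T : ℝ → ℝ} (h : IsTrigPoly n T) : Function.Periodic T (2*π) := by
  obtain ⟨a, b, h⟩ := h
  intro x
  rw [h, h]
  refine Finset.sum_congr rfl fun k _ => ?_
  rw [mul_add, Real.cos_add_nat_mul_two_pi, Real.sin_add_nat_mul_two_pi]

lemma perL1 {T : ℝ → ℝ} (h : IsTrigPoly n T) : PerL1 T := PerL1.of_cont h.continuous h.periodic

/-- `∫ P(x-t) q(t) dt` is a trigonometric polynomial -/
lemma conv_left {T q : ℝ → ℝ} (h : IsTrigPoly n T) (hq : Continuous q) (a b : ℝ) :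
    IsTrigPoly n (fun x => ∫ t in a..b, T (x - t) * q t) := by
  obtain ⟨c, d, h⟩ := h
  have e : ∀ x, ∫ t in a..b, T (x - t) * q t = ∑ k ∈ Finset.range n,
      ((∫ t in a..b, (c k * Real.cos (k*t) - d k * Real.sin (k*t)) * q t) * Real.cos (k * x) +
       (∫ t in a..b, (c k * Real.sin (k*t) + d k * Real.cos (k*t)) * q t) * Real.sin (k * x)) := by
    intro x
    simp only [← intervalIntegral.integral_mul_const]
    have : ∀ k : ℕ, (∫ t in a..b, (c k * Real.cos (k*t) - d k * Real.sin (k*t)) * q t * Real.cos (k * x)) +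
       (∫ t in a..b, (c k * Real.sin (k*t) + d k * Real.cos (k*t)) * q t * Real.sin (k * x)) =
       ∫ t in a..b, (c k * Real.cos (k * (x - t)) + d k * Real.sin (k * (x - t))) * q t := by
      intro k
      rw [← intervalIntegral.integral_add]
      · refine intervalIntegral.integral_congr fun t _ => ?_
        simp only [mul_sub, Real.cos_sub, Real.sin_sub]; ring
      · exact Continuous.intervalIntegrable (by fun_prop) _ _
      · exact Continuous.intervalIntegrable (by fun_prop) _ _
    simp only [this]
    rw [← intervalIntegral.integral_finsetSum]
    · refine intervalIntegral.integral_congr fun t _ => ?_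
      simp only [h, Finset.sum_mul]
    · intro k _
      exact Continuous.intervalIntegrable (by fun_prop) _ _
  exact ⟨_, _, e⟩

/-- `∫ φ(x-t) T(t) dt` is a trigonometric polynomial -/
lemma conv_right {T φ : ℝ → ℝ} (h : IsTrigPoly n T) (hφ : PerL1 φ) :
    IsTrigPoly n (fun x => ∫ t in (-π)..π, φ (x - t) * T t) := by
  have e : ∀ x, ∫ t in (-π)..π, φ (x - t) * T t = ∫ t in (-π)..π, φ t * T (x - t) := by
    intro x
    have hp : Function.Periodic (fun t => φ t * T (x - t)) (2*π) := fun t => by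
      simp only [hφ.2 t]
      rw [← h.periodic (x - (t + 2*π))]; ring_nf
    have := per_refl hp x
    rw [← this]
    simp
  obtain ⟨c, d, h'⟩ := h
  have I1 : ∀ k : ℕ, IntervalIntegrable (fun t => φ t * Real.cos (k*t)) volume (-π) π := fun k =>
    hφ.1.mul_continuousOn (by fun_prop)
  have I2 : ∀ k : ℕ, IntervalIntegrable (fun t => φ t * Real.sin (k*t)) volume (-π) π := fun k =>
    hφ.1.mul_continuousOn (by fun_prop)
  refine ⟨fun k => c k * (∫ t in (-π)..π, φ t * Real.cos (k*t)) - d k * (∫ t in (-π)..π, φ t * Real.sin (k*t)),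
    fun k => c k * (∫ t in (-π)..π, φ t * Real.sin (k*t)) + d k * (∫ t in (-π)..π, φ t * Real.cos (k*t)),
    fun x => ?_⟩
  beta_reduce
  rw [e]
  have : ∀ t, φ t * T (x - t) = ∑ k ∈ Finset.range n,
      ((c k * Real.cos (k*x) + d k * Real.sin (k*x)) * (φ t * Real.cos (k*t)) +
       (c k * Real.sin (k*x) - d k * Real.cos (k*x)) * (φ t * Real.sin (k*t))) := by
    intro t
    rw [h', Finset.mul_sum]
    refine Finset.sum_congr rfl fun k _ => ?_
    simp only [mul_sub, Real.cos_sub, Real.sin_sub]; ring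
  simp only [this]
  rw [intervalIntegral.integral_finsetSum]
  · refine Finset.sum_congr rfl fun k _ => ?_
    rw [intervalIntegral.integral_add ((I1 k).const_mul _) ((I2 k).const_mul _),
      intervalIntegral.integral_const_mul, intervalIntegral.integral_const_mul]
    ring
  · intro k _
    exact ((I1 k).const_mul _).add ((I2 k).const_mul _)

end IsTrigPoly

lemma int_cos_int (k : ℤ) : ∫ t in (-π)..π, Real.cos (k * t) = if k = 0 then 2 * π else 0 := by
  split_ifs with h
  · subst h; simp; ring
  · have hk : (k:ℝ) ≠ 0 := by exact_mod_cast h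
    rw [intervalIntegral.integral_comp_mul_left _ hk]
    simp [Real.sin_int_mul_pi]

lemma sq_expand (d : ℕ → ℝ) (m : ℕ) (t : ℝ) :
    (∑ l ∈ Finset.range m, d l * Real.cos (l*t))^2 + (∑ l ∈ Finset.range m, d l * Real.sin (l*t))^2
    = ∑ l ∈ Finset.range m, ∑ k ∈ Finset.range m, d l * d k * Real.cos (((l:ℤ) - (k:ℤ) : ℤ) * t) := by
  simp only [sq, Finset.sum_mul_sum, ← Finset.sum_add_distrib]
  refine Finset.sum_congr rfl fun l _ => Finset.sum_congr rfl fun k _ => ?_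
  push_cast
  rw [sub_mul, Real.cos_sub]; ring

lemma int_sq (d : ℕ → ℝ) (m : ℕ) :
    ∫ t in (-π)..π, ((∑ l ∈ Finset.range m, d l * Real.cos (l*t))^2 +
      (∑ l ∈ Finset.range m, d l * Real.sin (l*t))^2) = 2 * π * ∑ l ∈ Finset.range m, d l ^ 2 := by
  simp only [sq_expand]
  rw [intervalIntegral.integral_finsetSum (fun l _ => Continuous.intervalIntegrable (by fun_prop) _ _),
    Finset.mul_sum]
  refine Finset.sum_congr rfl fun l hl => ?_
  rw [intervalIntegral.integral_finsetSum (fun l _ => Continuous.intervalIntegrable (by fun_prop) _ _)]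
  simp only [intervalIntegral.integral_const_mul, int_cos_int]
  rw [Finset.sum_eq_single l]
  · simp; ring
  · intro k _ hk; rw [if_neg (by omega)]; simp
  · intro h; exact absurd hl h

lemma int_sq_cos (d : ℕ → ℝ) (m : ℕ) (hd : d m = 0) :
    ∫ t in (-π)..π, ((∑ l ∈ Finset.range m, d l * Real.cos (l*t))^2 +
      (∑ l ∈ Finset.range m, d l * Real.sin (l*t))^2) * Real.cos t
      = 2 * π * ∑ l ∈ Finset.range m, d l * d (l+1) := by
  have e : ∀ t, ((∑ l ∈ Finset.range m, d l * Real.cos (l*t))^2 +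
      (∑ l ∈ Finset.range m, d l * Real.sin (l*t))^2) * Real.cos t =
      ∑ l ∈ Finset.range m, ∑ k ∈ Finset.range m, (d l * d k / 2 * Real.cos (((l:ℤ) - (k:ℤ) + 1 : ℤ) * t)
        + d l * d k / 2 * Real.cos (((l:ℤ) - (k:ℤ) - 1 : ℤ) * t)) := by
    intro t
    rw [sq_expand, Finset.sum_mul]
    refine Finset.sum_congr rfl fun l _ => ?_
    rw [Finset.sum_mul]
    refine Finset.sum_congr rfl fun k _ => ?_
    push_cast
    rw [show ((l:ℝ) - k + 1) * t = ((l:ℝ) - k) * t + t by ring,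
      show ((l:ℝ) - k - 1) * t = ((l:ℝ) - k) * t - t by ring, Real.cos_add, Real.cos_sub]; ring
  simp only [e]
  rw [intervalIntegral.integral_finsetSum (fun l _ => Continuous.intervalIntegrable (by fun_prop) _ _)]
  have e2 : ∀ l ∈ Finset.range m, ∫ t in (-π)..π, ∑ k ∈ Finset.range m,
      (d l * d k / 2 * Real.cos (((l:ℤ) - (k:ℤ) + 1 : ℤ) * t)
        + d l * d k / 2 * Real.cos (((l:ℤ) - (k:ℤ) - 1 : ℤ) * t)) =
      (∑ k ∈ Finset.range m, if k = l + 1 then π * d l * d k else 0) +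
      ∑ k ∈ Finset.range m, if l = k + 1 then π * d l * d k else 0 := by
    intro l hl
    rw [intervalIntegral.integral_finsetSum (fun l _ => Continuous.intervalIntegrable (by fun_prop) _ _),
      ← Finset.sum_add_distrib]
    refine Finset.sum_congr rfl fun k _ => ?_
    rw [intervalIntegral.integral_add (Continuous.intervalIntegrable (by fun_prop) _ _)
      (Continuous.intervalIntegrable (by fun_prop) _ _), intervalIntegral.integral_const_mul,
      intervalIntegral.integral_const_mul, int_cos_int, int_cos_int]
    congr 1
    · by_cases h : k = l + 1
      · rw [if_pos (by omega), if_pos h]; ring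
      · rw [if_neg (by omega), if_neg h]; ring
    · by_cases h : l = k + 1
      · rw [if_pos (by omega), if_pos h]; ring
      · rw [if_neg (by omega), if_neg h]; ring
  rw [Finset.sum_congr rfl e2, Finset.sum_add_distrib]
  have e3 : ∀ l, (∑ k ∈ Finset.range m, if k = l + 1 then π * d l * d k else 0) =
      if l ∈ Finset.range m then π * d l * d (l+1) else
        (∑ k ∈ Finset.range m, if k = l + 1 then π * d l * d k else 0) := by
    intro l
    split_ifs with h
    · rw [Finset.sum_ite_eq']
      split_ifs with h2
      · rfl
      · have : l + 1 = m := by simp at h h2; omega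
        rw [this, hd]; ring
    · rfl
  have e4 : (∑ l ∈ Finset.range m, ∑ k ∈ Finset.range m, if k = l + 1 then π * d l * d k else 0) =
      ∑ l ∈ Finset.range m, π * d l * d (l+1) := by
    refine Finset.sum_congr rfl fun l hl => ?_
    rw [e3, if_pos hl]
  have e5 : (∑ l ∈ Finset.range m, ∑ k ∈ Finset.range m, if l = k + 1 then π * d l * d k else 0) =
      ∑ l ∈ Finset.range m, π * d l * d (l+1) := by
    rw [Finset.sum_comm, ← e4]
    refine Finset.sum_congr rfl fun l hl => Finset.sum_congr rfl fun k _ => ?_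
    split_ifs <;> ring
  rw [e4, e5, Finset.mul_sum, ← Finset.sum_add_distrib]
  refine Finset.sum_congr rfl fun l _ => by ring


def GoodMod (ω : ℝ → ℝ) : Prop := Continuous ω ∧ Monotone ω ∧
  (∀ s t : ℝ, 0 ≤ s → 0 ≤ t → ω (s + t) ≤ ω s + ω t) ∧ ω 0 = 0 ∧ ∀ t : ℝ, 0 ≤ ω t

lemma GoodMod.nsmul {ω : ℝ → ℝ} (h : GoodMod ω) (k : ℕ) {s : ℝ} (hs : 0 ≤ s) :
    ω (k * s) ≤ k * ω s := by
  induction k with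
  | zero => simp [h.2.2.2.1]
  | succ k ih =>
    push_cast
    rw [add_mul, add_mul, one_mul, one_mul]
    exact (h.2.2.1 _ _ (by positivity) hs).trans (by linarith)

lemma GoodMod.scale {ω : ℝ → ℝ} (h : GoodMod ω) {x s : ℝ} (hx : 0 ≤ x) (hs : 0 ≤ s) :
    ω (x * s) ≤ (x + 1) * ω s := by
  have h1 := Nat.le_ceil x
  have h2 := Nat.ceil_lt_add_one hx
  calc ω (x * s) ≤ ω (⌈x⌉₊ * s) := h.2.1 (by gcongr)
    _ ≤ ⌈x⌉₊ * ω s := h.nsmul _ hs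
    _ ≤ _ := by have := h.2.2.2.2 s; gcongr

lemma jackson_Q {n : ℕ} (d : ℕ → ℝ) (hdn : d n = 0) : ∃ Q : ℝ → ℝ, Continuous Q ∧ IsTrigPoly n Q ∧
    (∀ t, 0 ≤ Q t) ∧ (∫ t in (-π)..π, Q t) = 2 * π * ∑ l ∈ Finset.range n, d l ^ 2 ∧
    (∫ t in (-π)..π, Q t * Real.cos t) = 2 * π * ∑ l ∈ Finset.range n, d l * d (l+1) := by
  refine ⟨fun t => (∑ l ∈ Finset.range n, d l * Real.cos (l*t))^2 +
      (∑ l ∈ Finset.range n, d l * Real.sin (l*t))^2, by fun_prop, ?_,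
      fun t => add_nonneg (sq_nonneg _) (sq_nonneg _), int_sq d n, int_sq_cos d n hdn⟩
  simp only [sq_expand]
  refine IsTrigPoly.sum _ fun l hl => IsTrigPoly.sum _ fun k hk => IsTrigPoly.cmul ?_ _
  have := IsTrigPoly.cos_int (n := n) (k := (l:ℤ) - k)
    (by simp at hl hk; rw [abs_lt]; omega) 0
  simpa using this

lemma jackson_corr {n : ℕ} (d : ℕ → ℝ) (θ : ℝ) (hd : ∀ l : ℕ, d l = Real.sin ((l + 1) * θ)) (hdn : d n = 0) :
    ∑ l ∈ Finset.range n, d l * d (l+1) = Real.cos θ * ∑ l ∈ Finset.range n, d l ^ 2 := by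
  have tel : ∀ m : ℕ, ∑ l ∈ Finset.range m, (d l * (2 * Real.cos θ * d l - d (l+1)) - d l * d (l+1))
      = - Real.sin (m * θ) * d m := by
    intro m
    induction m with
    | zero => simp
    | succ m ih =>
      rw [Finset.sum_range_succ, ih]
      have r : 2 * Real.cos θ * d m = d (m+1) + Real.sin (m*θ) := by
        simp only [hd]; push_cast
        rw [show ((m:ℝ)+1+1)*θ = (m+1)*θ + θ by ring, show (m:ℝ)*θ = (m+1)*θ - θ by ring,
          Real.sin_add, Real.sin_sub]; ring
      rw [r]; push_cast
      rw [← hd m]; ring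
  have t := tel n
  rw [hdn, mul_zero] at t
  have e : ∑ l ∈ Finset.range n, (d l * (2 * Real.cos θ * d l - d (l+1)) - d l * d (l+1)) =
     2 * Real.cos θ * ∑ l ∈ Finset.range n, d l ^ 2 - 2 * ∑ l ∈ Finset.range n, d l * d (l+1) := by
    rw [Finset.mul_sum, Finset.mul_sum, ← Finset.sum_sub_distrib]
    refine Finset.sum_congr rfl fun l _ => by ring
  rw [e] at t; linarith

lemma jackson_aux {n : ℕ} {Q : ℝ → ℝ} (hQc : Continuous Q) (hQT : IsTrigPoly n Q) (hQ0 : ∀ t, 0 ≤ Q t)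
    {D c : ℝ} (hD0 : 0 < D) (hQ1 : (∫ t in (-π)..π, Q t) = 2 * π * D)
    (hQ2 : (∫ t in (-π)..π, Q t * Real.cos t) = 2 * π * (c * D)) :
    ∃ J : ℝ → ℝ, IsTrigPoly n J ∧ (∀ t, 0 ≤ J t) ∧
    (∫ t in (-π)..π, J t) = 1 ∧ (∫ t in (-π)..π, t^2 * J t) ≤ π^2/2 * (1 - c) := by
  have hc : 0 < (2 * π * D)⁻¹ := by positivity
  refine ⟨fun t => (2 * π * D)⁻¹ * Q t, hQT.cmul _, fun t => mul_nonneg hc.le (hQ0 t), ?_, ?_⟩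
  · rw [intervalIntegral.integral_const_mul, hQ1, inv_mul_cancel₀]; positivity
  · have hle : ∫ t in (-π)..π, t^2 * ((2 * π * D)⁻¹ * Q t) ≤
        ∫ t in (-π)..π, (2 * π * D)⁻¹ * (π^2/2 * (Q t - Q t * Real.cos t)) := by
      refine intervalIntegral.integral_mono_on (by linarith [pi_pos])
        (Continuous.intervalIntegrable (by fun_prop) _ _)
        (Continuous.intervalIntegrable (by fun_prop) _ _) fun t ht => ?_
      have : t^2 ≤ π^2/2 * (1 - Real.cos t) := by
        have := Real.cos_le_one_sub_mul_cos_sq (x := t) (abs_le.2 ht)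
        have p := pi_pos
        have : 2/π^2 * t^2 ≤ 1 - Real.cos t := by linarith
        calc t^2 = π^2/2 * (2/π^2 * t^2) := by field_simp
          _ ≤ _ := by gcongr
      have := mul_le_mul_of_nonneg_right this (mul_nonneg hc.le (hQ0 t))
      calc _ ≤ _ := this
        _ = _ := by ring
    rw [intervalIntegral.integral_const_mul, intervalIntegral.integral_const_mul,
      intervalIntegral.integral_sub (hQc.intervalIntegrable _ _)
        (Continuous.intervalIntegrable (by fun_prop) _ _), hQ1, hQ2] at hle
    have e : (2 * π * D)⁻¹ * (π^2/2 * (2 * π * D - 2 * π * (c * D))) = π^2/2 * (1 - c) := by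
      field_simp
    rwa [e] at hle

lemma jackson_kernel {n : ℕ} (hn : 1 ≤ n) : ∃ J : ℝ → ℝ, IsTrigPoly n J ∧ (∀ t, 0 ≤ J t) ∧
    (∫ t in (-π)..π, J t) = 1 ∧ (∫ t in (-π)..π, t^2 * J t) * n^2 ≤ 25 := by
  have hn' : (1:ℝ) ≤ n := by exact_mod_cast hn
  obtain ⟨θ, hθ⟩ : ∃ θ, θ = π / (n + 1) := ⟨_, rfl⟩
  have hθ0 : 0 < θ := by rw [hθ]; positivity
  obtain ⟨d, hd⟩ : ∃ d : ℕ → ℝ, ∀ l : ℕ, d l = Real.sin ((l + 1) * θ) := ⟨_, fun _ => rfl⟩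
  have hθn : (n + 1) * θ = π := by rw [hθ]; field_simp
  have hdn : d n = 0 := by rw [hd, hθn, Real.sin_pi]
  have hD0 : 0 < ∑ l ∈ Finset.range n, d l ^ 2 := by
    refine Finset.sum_pos' (fun l _ => sq_nonneg _) ⟨0, Finset.mem_range.2 (by omega), ?_⟩
    have : 0 < Real.sin θ := Real.sin_pos_of_pos_of_lt_pi hθ0 (by nlinarith)
    simp only [hd, Nat.cast_zero, zero_add, one_mul]; positivity
  obtain ⟨Q, q1, q2, q3, q4, q5⟩ := jackson_Q (n := n) d hdn
  rw [jackson_corr d θ hd hdn] at q5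
  obtain ⟨J, j1, j2, j3, hle⟩ := jackson_aux q1 q2 q3 hD0 q4 q5
  refine ⟨J, j1, j2, j3, ?_⟩
  have c1 := Real.one_sub_sq_div_two_le_cos (x := θ)
  have c2 : θ * n ≤ π := by nlinarith
  have c3 : (θ * n)^2 ≤ π^2 := by gcongr
  have p1 : π < 3.15 := Real.pi_lt_d2
  have p0 := pi_pos
  have c4 : π^2 ≤ 9.9225 := by nlinarith
  calc _ ≤ π^2/2 * (1 - Real.cos θ) * n^2 := by gcongr
    _ ≤ π^2/2 * (θ^2/2) * n^2 := by gcongr; linarith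
    _ = π^2/4 * (θ*n)^2 := by ring
    _ ≤ π^2/4 * π^2 := by gcongr
    _ ≤ 25 := by nlinarith [sq_nonneg π]

lemma neg_shift {φ W : ℝ → ℝ} (hφ : PerL1 φ)
    (hW : ∀ t, 0 ≤ t → ∫ x in (-π)..π, |φ (x + t) - φ x| ≤ W t) (t : ℝ) :
    ∫ x in (-π)..π, |φ x - φ (x - t)| ≤ W |t| := by
  rcases le_total 0 t with h | h
  · rw [abs_of_nonneg h]
    have hp : Function.Periodic (fun x => |φ (x + t) - φ x|) (2*π) := fun x => by
      simp only [hφ.2 x, show x + 2*π + t = x + t + 2*π by ring, hφ.2 (x + t)]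
    have := per_shift hp (-t)
    refine le_trans (le_of_eq ?_) (hW t h)
    rw [← this]
    refine intervalIntegral.integral_congr fun x _ => ?_
    show _ = |φ (x + -t + t) - φ (x + -t)|
    congr 2; ring_nf
  · rw [abs_of_nonpos h]
    refine le_trans (le_of_eq ?_) (hW (-t) (by linarith))
    refine intervalIntegral.integral_congr fun x _ => ?_
    show |φ x - φ (x - t)| = |φ (x + -t) - φ x|
    rw [abs_sub_comm]; rfl

lemma jackson {φ ω : ℝ → ℝ} (hφ : PerL1 φ) (hω : GoodMod ω)
    (hW : ∀ t, 0 ≤ t → ∫ x in (-π)..π, |φ (x + t) - φ x| ≤ ω t) {n : ℕ} (hn : 1 ≤ n) :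
    ∃ P, IsTrigPoly n P ∧ norm1 (fun x => φ x - P x) ≤ 14 * ω (1 / n) := by
  have hn' : (1:ℝ) ≤ n := by exact_mod_cast hn
  have hpi : -π ≤ π := by linarith [pi_pos]
  obtain ⟨J, hJ, hJ0, hJ1, hJ2⟩ := jackson_kernel hn
  refine ⟨_, hJ.conv_right hφ, ?_⟩
  have hJc := hJ.continuous
  have hωc := hω.1
  have e : ∀ x, φ x - ∫ t in (-π)..π, φ (x - t) * J t = ∫ t in (-π)..π, (φ x - φ (x - t)) * J t := by
    intro x
    simp only [sub_mul]
    rw [intervalIntegral.integral_sub (Continuous.intervalIntegrable (by fun_prop) _ _)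
      (hφ.mul_cont hJc _ _ _), intervalIntegral.integral_const_mul, hJ1, mul_one]
  have hF : Integrable (fun p : ℝ × ℝ => (φ p.1 - φ (p.1 - p.2)) * J p.2)
      ((volume.restrict (Set.Ioc (-π) π)).prod (volume.restrict (Set.Ioc (-π) π))) := by
    have i1 := prod_int_sub hφ hJc 0 (-π) π
    have i2 : Integrable (fun p : ℝ × ℝ => φ p.1 * J p.2)
      ((volume.restrict (Set.Ioc (-π) π)).prod (volume.restrict (Set.Ioc (-π) π))) :=
      Integrable.mul_prod ((intervalIntegrable_iff_integrableOn_Ioc_of_le hpi).1 hφ.1)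
        hJc.integrableOn_Ioc
    convert i2.sub i1 using 2
    simp; ring
  have m := (minkowski (W := fun t => ω |t| * J t) hpi hF
    (Continuous.intervalIntegrable (by fun_prop) _ _) (fun t _ => by
      simp only [abs_mul, intervalIntegral.integral_mul_const, abs_of_nonneg (hJ0 t)]
      exact mul_le_mul_of_nonneg_right (neg_shift hφ hW t) (hJ0 t))).2
  simp only [norm1, e]
  refine m.trans ?_
  have w0 := hω.2.2.2.2 (1/n)
  have hle : ∫ t in (-π)..π, ω |t| * J t ≤
      ∫ t in (-π)..π, ω (1/n) * (3/2 * J t + n^2/2 * (t^2 * J t)) := by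
    refine intervalIntegral.integral_mono_on hpi
        (Continuous.intervalIntegrable (by fun_prop) _ _)
        (Continuous.intervalIntegrable (by fun_prop) _ _) fun t ht => ?_
    have h1 := hω.scale (x := n * |t|) (s := 1/n) (by positivity) (by positivity)
    rw [show (n:ℝ) * |t| * (1/n) = |t| by field_simp] at h1
    have h2 : n * |t| ≤ 1/2 + n^2/2*t^2 := by
      rw [← sq_abs t]; nlinarith [sq_nonneg (n*|t| - 1)]
    have h3 : ω |t| ≤ (3/2 + n^2/2*t^2) * ω (1/n) := h1.trans (mul_le_mul_of_nonneg_right (by linarith) w0)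
    calc _ ≤ (3/2 + n^2/2*t^2) * ω (1/n) * J t := mul_le_mul_of_nonneg_right h3 (hJ0 t)
      _ = _ := by ring
  refine hle.trans ?_
  rw [intervalIntegral.integral_const_mul, intervalIntegral.integral_add
    (Continuous.intervalIntegrable (by fun_prop) _ _)
    (Continuous.intervalIntegrable (by fun_prop) _ _), intervalIntegral.integral_const_mul,
    intervalIntegral.integral_const_mul, hJ1]
  nlinarith

structure Seq2 (a : ℕ → ℝ) : Prop where
  nn : ∀ j, 0 ≤ a j
  sm : Summable (fun j : ℕ => a j * ((j:ℝ)+1)^2)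
  cv : ∀ j, 0 ≤ a j - 2 * a (j+1) + a (j+2)

lemma abel_fin (a b : ℕ → ℝ) (P1 P2 : ℕ → ℝ) (h10 : P1 0 = 0) (h1 : ∀ m, P1 (m+1) = P1 m + b m)
    (h20 : P2 0 = 0) (h2 : ∀ m, P2 (m+1) = P2 m + P1 (m+1)) (N : ℕ) :
    ∑ j ∈ Finset.range N, (a j - 2 * a (j+1) + a (j+2)) * P2 (j+1) =
    ∑ j ∈ Finset.range N, a j * b j - a N * P1 N - (a N - a (N+1)) * P2 N := by
  induction N with
  | zero => simp [h10, h20]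
  | succ N ih =>
    rw [Finset.sum_range_succ, Finset.sum_range_succ, ih, h2 N, h1 N]; ring

lemma Seq2.summable {a : ℕ → ℝ} (h : Seq2 a) : Summable a := by
  refine Summable.of_nonneg_of_le h.nn (fun j => ?_) h.sm
  have k0 : (0:ℝ) ≤ j := j.cast_nonneg
  nlinarith [h.nn j, mul_nonneg (h.nn j) k0, mul_nonneg (h.nn j) (sq_nonneg (j:ℝ))]

lemma Seq2.summable_b {a b : ℕ → ℝ} (h : Seq2 a) (hb : ∀ j, |b j| ≤ 2) :
    Summable (fun j => a j * b j) := by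
  refine Summable.of_norm_bounded (h.summable.mul_right 2) fun j => ?_
  rw [Real.norm_eq_abs, abs_mul, abs_of_nonneg (h.nn j)]
  exact mul_le_mul_of_nonneg_left (hb j) (h.nn j)

lemma abel2 {a b : ℕ → ℝ} (h : Seq2 a) (hb : ∀ j, |b j| ≤ 2) (P1 P2 : ℕ → ℝ) (h10 : P1 0 = 0)
    (h1 : ∀ m, P1 (m+1) = P1 m + b m)
    (h20 : P2 0 = 0) (h2 : ∀ m, P2 (m+1) = P2 m + P1 (m+1)) (hP : ∀ m, 0 ≤ P2 m) :
    HasSum (fun j => (a j - 2 * a (j+1) + a (j+2)) * P2 (j+1)) (∑' j, a j * b j) := by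
  have hs := h.summable_b hb
  rw [hasSum_iff_tendsto_nat_of_nonneg (fun j => mul_nonneg (h.cv j) (hP _))]
  simp only [abel_fin a b P1 P2 h10 h1 h20 h2]
  have b1 : ∀ m : ℕ, |P1 m| ≤ 2 * m := by
    intro m
    induction m with
    | zero => simp [h10]
    | succ m ih => rw [h1]; push_cast; exact (abs_add_le _ _).trans (by linarith [hb m])
  have b2 : ∀ m : ℕ, |P2 m| ≤ 2 * m * m := by
    intro m
    induction m with
    | zero => simp [h20]
    | succ m ih =>
      rw [h2]
      have := b1 (m+1)
      push_cast at this ⊢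
      have m0 : (0:ℝ) ≤ m := m.cast_nonneg
      exact (abs_add_le _ _).trans (by nlinarith)
  have t0 : Tendsto (fun N : ℕ => a N * ((N:ℝ)+1)^2) atTop (nhds 0) := h.sm.tendsto_atTop_zero
  have t0' : Tendsto (fun N : ℕ => a (N+1) * (((N+1:ℕ):ℝ)+1)^2) atTop (nhds 0) :=
    t0.comp (tendsto_add_atTop_nat 1)
  have t1 : Tendsto (fun N => a N * P1 N) atTop (nhds 0) := by
    refine squeeze_zero_norm (fun N => ?_) (by simpa using t0.const_mul 2)
    rw [Real.norm_eq_abs, abs_mul, abs_of_nonneg (h.nn N)]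
    have n0 : (0:ℝ) ≤ N := N.cast_nonneg
    calc a N * |P1 N| ≤ a N * (2 * ((N:ℝ)+1)^2) :=
          mul_le_mul_of_nonneg_left ((b1 N).trans (by nlinarith)) (h.nn N)
      _ = _ := by ring
  have t2 : Tendsto (fun N => (a N - a (N+1)) * P2 N) atTop (nhds 0) := by
    refine squeeze_zero_norm (fun N => ?_) (by simpa using (t0.add t0').const_mul 2)
    rw [Real.norm_eq_abs, abs_mul]
    have n0 : (0:ℝ) ≤ N := N.cast_nonneg
    have a1 := h.nn N
    have a2 := h.nn (N+1)
    have e1 : |a N - a (N+1)| ≤ a N + a (N+1) := by rw [abs_le]; constructor <;> linarith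
    have e2 := b2 N
    calc |a N - a (N+1)| * |P2 N| ≤ (a N + a (N+1)) * (2 * N * N) := by gcongr
      _ ≤ _ := by
        have q1 : a N * (2*N*N) ≤ 2 * (a N * ((N:ℝ)+1)^2) := by
          have : (0:ℝ) ≤ a N * (4 * N + 2) := by positivity
          nlinarith
        have q2 : a (N+1) * (2*N*N) ≤ 2 * (a (N+1) * ((N:ℝ)+1+1)^2) := by
          have : (0:ℝ) ≤ a (N+1) * (8 * N + 8) := by positivity
          nlinarith
        linarith
  simpa using (hs.hasSum.tendsto_sum_nat.sub t1).sub t2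

def PhiF (m : ℕ) (t : ℝ) : ℝ :=
  (∑ l ∈ Finset.range m, Real.cos (l*t))^2 + (∑ l ∈ Finset.range m, Real.sin (l*t))^2

def PhiD (m : ℕ) (t : ℝ) : ℝ :=
  2 * ((∑ l ∈ Finset.range m, Real.cos (l*t)) * (-∑ l ∈ Finset.range m, (l:ℝ) * Real.sin (l*t)) +
   (∑ l ∈ Finset.range m, Real.sin (l*t)) * (∑ l ∈ Finset.range m, (l:ℝ) * Real.cos (l*t)))

lemma PhiF_nonneg (m : ℕ) (t : ℝ) : 0 ≤ PhiF m t := add_nonneg (sq_nonneg _) (sq_nonneg _)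

lemma PhiD_cont (m : ℕ) : Continuous (PhiD m) := by unfold PhiD; fun_prop

lemma PhiD_per (m : ℕ) : Function.Periodic (PhiD m) (2*π) := by
  intro t
  unfold PhiD
  simp only [mul_add, Real.cos_add_nat_mul_two_pi, Real.sin_add_nat_mul_two_pi]

lemma PhiF_deriv (m : ℕ) (t : ℝ) : HasDerivAt (PhiF m) (PhiD m t) t := by
  have h1 : HasDerivAt (fun t => ∑ l ∈ Finset.range m, Real.cos (l*t))
      (-∑ l ∈ Finset.range m, (l:ℝ) * Real.sin (l*t)) t := by
    rw [← Finset.sum_neg_distrib]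
    refine HasDerivAt.fun_sum fun l _ => ?_
    have := ((hasDerivAt_id' t).const_mul (l:ℝ)).cos
    exact this.congr_deriv (by ring)
  have h2 : HasDerivAt (fun t => ∑ l ∈ Finset.range m, Real.sin (l*t))
      (∑ l ∈ Finset.range m, (l:ℝ) * Real.cos (l*t)) t := by
    refine HasDerivAt.fun_sum fun l _ => ?_
    have := ((hasDerivAt_id' t).const_mul (l:ℝ)).sin
    exact this.congr_deriv (by ring)
  have := (h1.pow 2).add (h2.pow 2)
  exact this.congr_deriv (by simp only [PhiD, Nat.cast_ofNat, Nat.add_one_sub_one, pow_one]; ring)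

lemma PhiF_diff (m : ℕ) {x y s t : ℝ} (hxs : x ≤ s) (hs : s ≤ y) (hxt : x ≤ t) (ht : t ≤ y) :
    |PhiF m t - PhiF m s| ≤ ∫ u in x..y, |PhiD m u| := by
  have hc := PhiD_cont m
  wlog hst : s ≤ t generalizing s t
  · rw [abs_sub_comm]; exact this hxt ht hxs hs (le_of_not_ge hst)
  have e : ∫ u in s..t, PhiD m u = PhiF m t - PhiF m s :=
    intervalIntegral.integral_eq_sub_of_hasDerivAt (fun u _ => PhiF_deriv m u)
      (hc.intervalIntegrable _ _)
  rw [← e]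
  refine (intervalIntegral.abs_integral_le_integral_abs hst).trans ?_
  exact intervalIntegral.integral_mono_interval hxs hst ht
    (Eventually.of_forall fun _ => abs_nonneg _) (hc.abs.intervalIntegrable _ _)

lemma PhiD_int (j : ℕ) : ∫ u in (-π)..π, |PhiD (j+1) u| ≤ 4 * π * ((j+1) * j) := by
  have hpi : -π ≤ π := by linarith [pi_pos]
  rcases Nat.eq_zero_or_pos j with rfl | hj
  · simp [PhiD]
  have hj' : (0:ℝ) < j := by exact_mod_cast hj
  have i1 := int_sq (fun _ => 1) (j+1)
  have i2 := int_sq (fun l => (l:ℝ)) (j+1)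
  simp only [one_mul, one_pow, Finset.sum_const, Finset.card_range, nsmul_eq_mul, mul_one] at i1
  have i3 : ∑ l ∈ Finset.range (j+1), (l:ℝ)^2 ≤ (j+1) * j^2 := by
    calc _ ≤ ∑ l ∈ Finset.range (j+1), (j:ℝ)^2 := by
          refine Finset.sum_le_sum fun l hl => ?_
          have : (l:ℝ) ≤ j := by exact_mod_cast Nat.lt_succ_iff.1 (Finset.mem_range.1 hl)
          gcongr
      _ = _ := by simp
  have hle : ∫ u in (-π)..π, |PhiD (j+1) u| ≤
     ∫ t in (-π)..π, ((j:ℝ) * ((∑ l ∈ Finset.range (j+1), Real.cos (l*t))^2 +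
      (∑ l ∈ Finset.range (j+1), Real.sin (l*t))^2) +
      (1/j) * ((∑ l ∈ Finset.range (j+1), (l:ℝ) * Real.cos (l*t))^2 +
      (∑ l ∈ Finset.range (j+1), (l:ℝ) * Real.sin (l*t))^2)) := by
    refine intervalIntegral.integral_mono_on hpi ((PhiD_cont _).abs.intervalIntegrable _ _)
      (Continuous.intervalIntegrable (by fun_prop) _ _) fun t _ => ?_
    unfold PhiD
    generalize (∑ l ∈ Finset.range (j+1), Real.cos (l*t)) = A
    generalize (∑ l ∈ Finset.range (j+1), Real.sin (l*t)) = B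
    generalize (∑ l ∈ Finset.range (j+1), (l:ℝ) * Real.cos (l*t)) = A'
    generalize (∑ l ∈ Finset.range (j+1), (l:ℝ) * Real.sin (l*t)) = B'
    have key : (j:ℝ) * (A^2+B^2) + (1/j) * (A'^2 + B'^2) = (1/j) * ((j*A)^2 + (j*B)^2 + A'^2 + B'^2) := by
      field_simp
      ring
    have k2 : ∀ X : ℝ, X = (1/j) * (j * X) := fun X => by field_simp
    rw [key, abs_le]
    constructor
    · rw [neg_le, k2 (-(2 * (A * -B' + B * A')))]
      refine mul_le_mul_of_nonneg_left ?_ (by positivity)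
      nlinarith [sq_nonneg (j*A - B'), sq_nonneg (j*B + A')]
    · rw [k2 (2 * (A * -B' + B * A'))]
      refine mul_le_mul_of_nonneg_left ?_ (by positivity)
      nlinarith [sq_nonneg (j*A + B'), sq_nonneg (j*B - A')]
  refine hle.trans ?_
  rw [intervalIntegral.integral_add (Continuous.intervalIntegrable (by fun_prop) _ _)
    (Continuous.intervalIntegrable (by fun_prop) _ _), intervalIntegral.integral_const_mul,
    intervalIntegral.integral_const_mul, i1, i2]
  calc _ ≤ (j:ℝ) * (2 * π * ((j+1:ℕ):ℝ)) + 1/j * (2 * π * ((j+1) * j^2)) := by gcongr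
    _ = _ := by push_cast; field_simp; ring

def bq (t : ℝ) (j : ℕ) : ℝ := if j = 0 then 1 else 2 * Real.cos (j * t)

lemma bq_le (t : ℝ) (j : ℕ) : |bq t j| ≤ 2 := by
  unfold bq
  split_ifs
  · norm_num
  · rw [abs_mul, abs_two]; linarith [Real.abs_cos_le_one (j*t)]

lemma PhiF_succ (m : ℕ) (t : ℝ) : PhiF (m+1) t = PhiF m t + ∑ j ∈ Finset.range (m+1), bq t j := by
  rw [Finset.sum_range_succ']
  have e : ∑ k ∈ Finset.range m, bq t (k+1) = ∑ l ∈ Finset.range m, 2 * Real.cos (m*t - l*t) := by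
    rw [← Finset.sum_range_reflect]
    refine Finset.sum_congr rfl fun l hl => ?_
    have hl := Finset.mem_range.1 hl
    simp only [bq, Nat.add_eq_zero_iff, one_ne_zero, and_false, if_false]
    rw [show m - 1 - l + 1 = m - l by omega, Nat.cast_sub hl.le, sub_mul]
  rw [e]
  simp only [PhiF, Finset.sum_range_succ, bq, if_true, Real.cos_sub]
  have : ∑ l ∈ Finset.range m, 2 * (Real.cos (m*t) * Real.cos (l*t) + Real.sin (m*t) * Real.sin (l*t))
    = 2 * Real.cos (m*t) * (∑ l ∈ Finset.range m, Real.cos (l*t)) +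
      2 * Real.sin (m*t) * (∑ l ∈ Finset.range m, Real.sin (l*t)) := by
    rw [Finset.mul_sum, Finset.mul_sum, ← Finset.sum_add_distrib]
    refine Finset.sum_congr rfl fun l _ => by ring
  rw [this]
  nlinarith [Real.sin_sq_add_cos_sq (m*t)]

def GG (a : ℕ → ℝ) (t : ℝ) : ℝ := ∑' j, a j * bq t j

lemma GG_hasSum {a : ℕ → ℝ} (h : Seq2 a) (t : ℝ) :
    HasSum (fun j => (a j - 2 * a (j+1) + a (j+2)) * PhiF (j+1) t) (GG a t) :=
  abel2 h (bq_le t) (fun m => ∑ j ∈ Finset.range m, bq t j) (fun m => PhiF m t) (by simp)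
    (fun m => Finset.sum_range_succ _ _) (by simp [PhiF]) (fun m => PhiF_succ m t)
    (fun m => PhiF_nonneg m t)

lemma GG_nonneg {a : ℕ → ℝ} (h : Seq2 a) (t : ℝ) : 0 ≤ GG a t :=
  (GG_hasSum h t).nonneg fun j => mul_nonneg (h.cv j) (PhiF_nonneg _ _)

lemma c_hasSum {a : ℕ → ℝ} (h : Seq2 a) :
    HasSum (fun j : ℕ => (a j - 2 * a (j+1) + a (j+2)) * (((j:ℝ)+1) * j)) (2 * ∑' j, a (j+1)) := by
  have hb : ∀ j : ℕ, |(if j = 0 then (0:ℝ) else 2)| ≤ 2 := fun j => by split_ifs <;> norm_num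
  have := abel2 h hb (fun m => if m = 0 then 0 else 2 * ((m:ℝ)-1)) (fun m => (m:ℝ) * (m-1)) (by simp)
    (fun m => by rcases Nat.eq_zero_or_pos m with rfl | h
                 · simp
                 · simp [h.ne']; ring) (by simp) (fun m => by simp; ring) (fun m => by
      rcases Nat.eq_zero_or_pos m with rfl | h
      · simp
      · have : (1:ℝ) ≤ m := by exact_mod_cast h
        exact mul_nonneg (by linarith) (by linarith))
  convert this using 1
  · ext j; push_cast; ring
  · rw [(h.summable_b hb).tsum_eq_zero_add]
    simp only [if_true, mul_zero, zero_add, Nat.add_eq_zero_iff, one_ne_zero, and_false, if_false]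
    rw [tsum_mul_right, mul_comm]

lemma GG_cont {a : ℕ → ℝ} (h : Seq2 a) : Continuous (GG a) := by
  refine continuous_tsum (u := fun j => a j * 2) (fun j => ?_) (h.summable.mul_right 2) fun j t => ?_
  · unfold bq; split_ifs <;> fun_prop
  · rw [Real.norm_eq_abs, abs_mul, abs_of_nonneg (h.nn j)]
    exact mul_le_mul_of_nonneg_left (bq_le t j) (h.nn j)

lemma GG_per (a : ℕ → ℝ) : Function.Periodic (GG a) (2*π) := by
  intro t
  unfold GG bq
  simp only [mul_add, Real.cos_add_nat_mul_two_pi]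

lemma bq_int (j : ℕ) : ∫ t in (-π)..π, bq t j = if j = 0 then 2 * π else 0 := by
  unfold bq
  split_ifs with h
  · simp; ring
  · have := int_cos_int j
    rw [intervalIntegral.integral_const_mul]
    simp only [Int.cast_natCast] at this
    rw [this]; simp [h]

lemma GG_int {a : ℕ → ℝ} (h : Seq2 a) : ∫ t in (-π)..π, GG a t = 2 * π * a 0 := by
  have hc : ∀ j, Continuous fun t => a j * bq t j := fun j => by
    unfold bq; split_ifs <;> fun_prop
  have := intervalIntegral.hasSum_integral_of_dominated_convergence (μ := volume) (a := -π) (b := π)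
    (F := fun j t => a j * bq t j) (f := GG a) (fun j _ => a j * 2)
    (fun j => (hc j).aestronglyMeasurable)
    (fun j => Eventually.of_forall fun t _ => by
      rw [Real.norm_eq_abs, abs_mul, abs_of_nonneg (h.nn j)]
      exact mul_le_mul_of_nonneg_left (bq_le t j) (h.nn j))
    (Eventually.of_forall fun t _ => h.summable.mul_right 2)
    (by simp) (Eventually.of_forall fun t _ => (h.summable_b (bq_le t)).hasSum)
  simp only [intervalIntegral.integral_const_mul, bq_int] at this
  refine this.unique ?_
  refine (hasSum_ite_eq 0 (2 * π * a 0)).congr_fun ?_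
  intro j
  split_ifs with hj
  · subst hj; ring
  · simp

/-- variation of `GG` over cells -/
lemma GG_var {a : ℕ → ℝ} (h : Seq2 a) (M : ℕ) (x : ℕ → ℝ) (hx : Monotone x) (hM : x M = x 0 + 2 * π) :
    ∃ V : ℕ → ℝ, (∀ k < M, ∀ s ∈ Set.Icc (x k) (x (k+1)), ∀ t ∈ Set.Icc (x k) (x (k+1)),
      |GG a t - GG a s| ≤ V k) ∧ ∑ k ∈ Finset.range M, V k ≤ 8 * π * ∑' j, a (j+1) := by
  have hcs := c_hasSum h
  have key : ∀ j, ∑ k ∈ Finset.range M, ∫ u in (x k)..(x (k+1)), |PhiD (j+1) u| =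
      ∫ u in (-π)..π, |PhiD (j+1) u| := by
    intro j
    rw [intervalIntegral.sum_integral_adjacent_intervals (fun k _ => (PhiD_cont _).abs.intervalIntegrable _ _),
      hM, per_int (fun t => by simp only [PhiD_per (j+1) t])]
  have c0 : ∀ k j, 0 ≤ ∫ u in (x k)..(x (k+1)), |PhiD (j+1) u| := fun k j =>
    intervalIntegral.integral_nonneg (hx (Nat.le_succ k)) fun _ _ => abs_nonneg _
  have cle : ∀ k < M, ∀ j : ℕ, ∫ u in (x k)..(x (k+1)), |PhiD (j+1) u| ≤ 4 * π * ((j+1) * j) := by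
    intro k hk j
    refine le_trans ?_ (PhiD_int j)
    rw [← key j]
    exact Finset.single_le_sum (f := fun k => ∫ u in (x k)..(x (k+1)), |PhiD (j+1) u|) (fun k _ => c0 k j)
      (Finset.mem_range.2 hk)
  have hsm : ∀ k < M, Summable fun j => (a j - 2 * a (j+1) + a (j+2)) * ∫ u in (x k)..(x (k+1)), |PhiD (j+1) u| := by
    intro k hk
    refine Summable.of_nonneg_of_le (fun j => mul_nonneg (h.cv j) (c0 k j)) (fun j => ?_)
      (hcs.summable.mul_left (4*π))
    calc _ ≤ (a j - 2 * a (j+1) + a (j+2)) * (4 * π * ((j+1) * j)) :=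
          mul_le_mul_of_nonneg_left (cle k hk j) (h.cv j)
      _ = _ := by ring
  refine ⟨fun k => ∑' j, (a j - 2 * a (j+1) + a (j+2)) * ∫ u in (x k)..(x (k+1)), |PhiD (j+1) u|, ?_, ?_⟩
  · intro k hk s hs t ht
    have hd := (GG_hasSum h t).sub (GG_hasSum h s)
    rw [← hd.tsum_eq, ← Real.norm_eq_abs]
    refine tsum_of_norm_bounded (hsm k hk).hasSum fun j => ?_
    rw [Real.norm_eq_abs, ← mul_sub, abs_mul, abs_of_nonneg (h.cv j)]
    exact mul_le_mul_of_nonneg_left (PhiF_diff _ hs.1 hs.2 ht.1 ht.2) (h.cv j)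
  · rw [← Summable.tsum_finsetSum (fun k hk => hsm k (Finset.mem_range.1 hk))]
    simp only [← Finset.mul_sum, key]
    have hh := hcs.mul_left (4*π)
    have : 8 * π * ∑' j, a (j+1) = 4 * π * (2 * ∑' j, a (j+1)) := by ring
    rw [this, ← hh.tsum_eq]
    have e : ∀ j : ℕ, (a j - 2 * a (j+1) + a (j+2)) * ∫ u in (-π)..π, |PhiD (j+1) u| ≤
      4 * π * ((a j - 2 * a (j+1) + a (j+2)) * (((j:ℝ)+1) * j)) := fun j => by
        calc _ ≤ (a j - 2 * a (j+1) + a (j+2)) * (4 * π * ((j+1) * j)) :=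
              mul_le_mul_of_nonneg_left (PhiD_int j) (h.cv j)
          _ = _ := by ring
    refine Summable.tsum_le_tsum e ?_ hh.summable
    exact Summable.of_nonneg_of_le (fun j => mul_nonneg (h.cv j)
      (intervalIntegral.integral_nonneg (by linarith [pi_pos]) fun _ _ => abs_nonneg _)) e hh.summable

def TailF (p : ℕ → ℝ) (n : ℕ) (γ t : ℝ) : ℝ := ∑' i : ℕ, p i * Real.cos (((i:ℝ) + n) * t + γ)

lemma Tail_summable {p : ℕ → ℝ} (hp : ∀ i, 0 ≤ p i) (hs : Summable p) (n : ℕ) (γ t : ℝ) :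
    Summable fun i : ℕ => p i * Real.cos (((i:ℝ) + n) * t + γ) := by
  refine Summable.of_norm_bounded hs fun j => ?_
  rw [Real.norm_eq_abs, abs_mul, abs_of_nonneg (hp j)]
  exact mul_le_of_le_one_right (hp j) (Real.abs_cos_le_one _)

lemma Tail_cont {p : ℕ → ℝ} (hp : ∀ i, 0 ≤ p i) (hs : Summable p) (n : ℕ) (γ : ℝ) :
    Continuous (TailF p n γ) := by
  refine continuous_tsum (u := p) (fun j => by fun_prop) hs fun j t => ?_
  rw [Real.norm_eq_abs, abs_mul, abs_of_nonneg (hp j)]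
  exact mul_le_of_le_one_right (hp j) (Real.abs_cos_le_one _)

lemma Tail_le {p : ℕ → ℝ} (hp : ∀ i, 0 ≤ p i) (hs : Summable p) (n : ℕ) (γ t : ℝ) :
    |TailF p n γ t| ≤ ∑' i, p i := by
  rw [← Real.norm_eq_abs]
  refine tsum_of_norm_bounded hs.hasSum fun j => ?_
  rw [Real.norm_eq_abs, abs_mul, abs_of_nonneg (hp j)]
  exact mul_le_of_le_one_right (hp j) (Real.abs_cos_le_one _)

lemma Tail_sin {p : ℕ → ℝ} (hp : ∀ i, 0 ≤ p i) (ha : ∀ i, p (i+1) ≤ p i) (hs : Summable p) (n : ℕ) (γ t : ℝ) :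
    |2 * Real.sin (t/2) * TailF p n γ t| ≤ 2 * p 0 := by
  obtain ⟨s, hsd⟩ : ∃ s : ℕ → ℝ, ∀ i : ℕ, s i = Real.sin (((i:ℝ) + n) * t + γ - t/2) := ⟨_, fun _ => rfl⟩
  have s1 : ∀ i, |s i| ≤ 1 := fun i => by rw [hsd]; exact Real.abs_sin_le_one _
  have e : ∀ i : ℕ, 2 * Real.sin (t/2) * (p i * Real.cos (((i:ℝ) + n) * t + γ)) = p i * (s (i+1) - s i) := by
    intro i
    rw [hsd, hsd]
    push_cast
    rw [show ((i:ℝ) + 1 + n) * t + γ - t/2 = ((i:ℝ) + n) * t + γ + t/2 by ring, Real.sin_add, Real.sin_sub]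
    ring
  have key : ∀ N : ℕ, |∑ i ∈ Finset.range N, p i * (s (i+1) - s i) - p N * s N| ≤ 2 * p 0 - p N ∧ p N ≤ p 0 := by
    intro N
    induction N with
    | zero =>
      simp only [Finset.range_zero, Finset.sum_empty, zero_sub, abs_neg, abs_mul, abs_of_nonneg (hp 0)]
      exact ⟨by nlinarith [s1 0, hp 0], le_rfl⟩
    | succ N ih =>
      refine ⟨?_, (ha N).trans ih.2⟩
      rw [Finset.sum_range_succ, show ∀ X : ℝ, X + p N * (s (N+1) - s N) - p (N+1) * s (N+1) =
        (X - p N * s N) + (p N - p (N+1)) * s (N+1) by intro X; ring]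
      refine (abs_add_le _ _).trans ?_
      rw [abs_mul, abs_of_nonneg (sub_nonneg.2 (ha N))]
      have := mul_le_of_le_one_right (sub_nonneg.2 (ha N)) (s1 (N+1))
      linarith [ih.1]
  have hh := ((Tail_summable hp hs n γ t).hasSum.mul_left (2 * Real.sin (t/2)))
  simp only [e] at hh
  refine le_of_tendsto hh.tendsto_sum_nat.abs (Eventually.of_forall fun N => ?_)
  have k := key N
  have : |p N * s N| ≤ p N := by
    rw [abs_mul, abs_of_nonneg (hp N)]; exact mul_le_of_le_one_right (hp N) (s1 N)
  have := abs_add_le (∑ i ∈ Finset.range N, p i * (s (i+1) - s i) - p N * s N) (p N * s N)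
  rw [sub_add_cancel] at this
  linarith [k.1]

lemma Tail_t {p : ℕ → ℝ} (hp : ∀ i, 0 ≤ p i) (ha : ∀ i, p (i+1) ≤ p i) (hs : Summable p) (n : ℕ) (γ t : ℝ)
    (ht : |t| ≤ π) : |t| * |TailF p n γ t| ≤ π * p 0 := by
  have h := Tail_sin hp ha hs n γ t
  have h2 := Real.mul_abs_le_abs_sin (x := t/2) (by rw [abs_div, abs_two]; linarith)
  rw [abs_mul, abs_mul, abs_two] at h
  rw [abs_div, abs_two] at h2
  have p0 := pi_pos
  have h3 : |t| ≤ π * |Real.sin (t/2)| := by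
    calc |t| = π * (2/π * (|t|/2)) := by field_simp
      _ ≤ _ := by gcongr
  calc _ ≤ (π * |Real.sin (t/2)|) * |TailF p n γ t| := by gcongr
    _ = π/2 * (2 * |Real.sin (t/2)| * |TailF p n γ t|) := by ring
    _ ≤ π/2 * (2 * p 0) := by gcongr
    _ = _ := by ring

lemma half_int {f : ℝ → ℝ} (hf : Continuous f) {L q : ℝ} (hL : 0 < L)
    (h1 : ∀ t ∈ Set.Icc 0 π, |f t| ≤ L * q) (h2 : ∀ t ∈ Set.Icc 0 π, t * |f t| ≤ π * q) :
    ∫ t in (0:ℝ)..π, |f t| ≤ 2 * π * q * Real.log (1 + L) := by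
  have p0 := pi_pos
  have hder : ∀ t ∈ Set.uIcc 0 π, HasDerivAt (fun t => Real.log (L * t + π)) (L / (L*t+π)) t := by
    intro t ht
    rw [Set.uIcc_of_le p0.le] at ht
    have : 0 < L * t + π := by have := ht.1; positivity
    have := (((hasDerivAt_id' t).const_mul L).add_const π).log this.ne'
    exact this.congr_deriv (by ring)
  have hci : ContinuousOn (fun t => L / (L*t+π)) (Set.uIcc 0 π) := by
    refine ContinuousOn.div (by fun_prop) (by fun_prop) fun t ht => ?_
    rw [Set.uIcc_of_le p0.le] at ht
    have := ht.1; positivity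
  have e := intervalIntegral.integral_eq_sub_of_hasDerivAt hder hci.intervalIntegrable
  have e2 : Real.log (L * π + π) - Real.log (L * 0 + π) = Real.log (1 + L) := by
    rw [← Real.log_div (by positivity) (by positivity)]
    congr 1; field_simp; ring
  rw [e2] at e
  rw [← e, ← intervalIntegral.integral_const_mul]
  refine intervalIntegral.integral_mono_on p0.le (hf.abs.intervalIntegrable _ _)
    (hci.intervalIntegrable.const_mul _) fun t ht => ?_
  have d : 0 < L * t + π := by have := ht.1; positivity
  rw [← mul_div_assoc, le_div_iff₀ d]
  have a1 := h1 t ht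
  have a2 := mul_le_mul_of_nonneg_left (h2 t ht) hL.le
  have a3 := mul_le_mul_of_nonneg_left (h1 t ht) p0.le
  nlinarith

lemma Tail_int {p : ℕ → ℝ} (hp : ∀ i, 0 ≤ p i) (ha : ∀ i, p (i+1) ≤ p i) (hs : Summable p) (n : ℕ) (γ : ℝ)
    {x : ℝ} (hx : 0 < x) (hS : ∑' i, p i ≤ p 0 * (1 + 12 * x)) :
    ∫ t in (-π)..π, |TailF p n γ t| ≤ 52 * π * (p 0 * (1 + max 0 (Real.log x))) := by
  have p0 := pi_pos
  have hc := Tail_cont hp hs n γ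
  set X := max 1 x with hX
  have X1 : 1 ≤ X := le_max_left _ _
  have X2 : x ≤ X := le_max_right _ _
  have hS' : ∑' i, p i ≤ 13 * X * p 0 := hS.trans (by nlinarith [hp 0])
  have q1 := half_int hc (L := 13 * X) (q := p 0) (by positivity)
    (fun t _ => (Tail_le hp hs n γ t).trans hS') (fun t ht => by
      have := Tail_t hp ha hs n γ t (by rw [abs_of_nonneg ht.1]; exact ht.2)
      rwa [abs_of_nonneg ht.1] at this)
  have q2 := half_int (f := fun t => TailF p n γ (-t)) (by fun_prop) (L := 13 * X) (q := p 0) (by positivity)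
    (fun t _ => (Tail_le hp hs n γ _).trans hS') (fun t ht => by
      have := Tail_t hp ha hs n γ (-t) (by rw [abs_neg, abs_of_nonneg ht.1]; exact ht.2)
      rwa [abs_neg, abs_of_nonneg ht.1] at this)
  have e1 : ∫ t in (0:ℝ)..π, |TailF p n γ (-t)| = ∫ t in (-π)..0, |TailF p n γ t| := by
    rw [intervalIntegral.integral_comp_neg (fun t => |TailF p n γ t|), neg_zero]
  rw [e1] at q2
  rw [← intervalIntegral.integral_add_adjacent_intervals (hc.abs.intervalIntegrable (-π) 0) (hc.abs.intervalIntegrable _ _)]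
  have l1 : Real.log (1 + 13 * X) ≤ 13 + max 0 (Real.log x) := by
    have : Real.log (1 + 13 * X) ≤ Real.log (14 * X) := Real.log_le_log (by positivity) (by linarith)
    rw [Real.log_mul (by norm_num) (by positivity)] at this
    have h14 := Real.log_le_sub_one_of_pos (show (0:ℝ) < 14 by norm_num)
    have : Real.log X = max 0 (Real.log x) := by
      rcases le_total 1 x with h | h
      · rw [hX, max_eq_right h, max_eq_right (Real.log_nonneg h)]
      · rw [hX, max_eq_left h, max_eq_left (Real.log_nonpos hx.le h), Real.log_one]
    linarith
  have l2 : 2 * π * p 0 * Real.log (1 + 13 * X) ≤ 2 * π * p 0 * (13 * (1 + max 0 (Real.log x))) := by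
    have := hp 0
    have := le_max_left 0 (Real.log x)
    gcongr; linarith
  linarith

lemma eN_scale (n : ℕ) (hn : 1 ≤ n) (ω : ℝ → ℝ) :
    ∫ u in (0:ℝ)..(π/(2*n)), ω (2 * u) * Real.sin (n * u) = eN n ω / n := by
  have hn' : (1:ℝ) ≤ n := by exact_mod_cast hn
  have := intervalIntegral.integral_comp_mul_left (a := 0) (b := π/(2*n))
    (fun v => ω (2 * v / n) * Real.sin v) (c := (n:ℝ)) (by positivity)
  simp only [mul_zero] at this
  rw [show (n:ℝ) * (π/(2*n)) = π/2 by field_simp, smul_eq_mul] at this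
  unfold eN
  refine Eq.trans ?_ (this.trans (div_eq_inv_mul _ _).symm)
  refine intervalIntegral.integral_congr fun u _ => ?_
  show _ = ω (2 * (n * u) / n) * Real.sin (n*u)
  congr 2; field_simp

lemma cell_diff {φ : ℝ → ℝ} (hφ : PerL1 φ) (n : ℕ) (hn : 1 ≤ n) (β' : ℝ) (k : ℕ) (x : ℝ) :
    ∫ t in ((β' + k * π)/n)..((β' + (k+1:ℕ) * π)/n), φ (x - t) * Real.cos (n * t - β') =
    (-(-1)^k) * ∫ u in (0:ℝ)..(π/(2*n)),
      (φ (x - (β' + π/2 + k*π)/n - u) - φ (x - (β' + π/2 + k*π)/n + u)) * Real.sin (n * u) := by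
  have hn' : (1:ℝ) ≤ n := by exact_mod_cast hn
  have hn0 : (n:ℝ) ≠ 0 := by positivity
  set c := (β' + π/2 + k*π)/n with hc
  set b := π/(2*n) with hb
  have e1 : (β' + k * π)/n = -b + c := by rw [hb, hc]; field_simp; ring
  have e2 : (β' + (k+1:ℕ) * π)/n = b + c := by rw [hb, hc]; push_cast; field_simp; ring
  have hcos : ∀ u, Real.cos (n * (u + c) - β') = (-(-1)^k) * Real.sin (n * u) := by
    intro u
    rw [show (n:ℝ) * (u + c) - β' = (n * u + π/2) + k * π by rw [hc]; field_simp; ring,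
      Real.cos_add_nat_mul_pi, Real.cos_add_pi_div_two]; ring
  rw [e1, e2, ← intervalIntegral.integral_comp_add_right (fun t => φ (x - t) * Real.cos (n * t - β'))]
  simp only [hcos]
  have hi : ∀ a b, IntervalIntegrable (fun u => φ (x - c - u) * Real.sin (n*u)) volume a b := fun a b =>
    hφ.mul_cont (by fun_prop) a b (x - c)
  have hi2 : ∀ a b, IntervalIntegrable (fun u => φ (x - c + u) * Real.sin (n*u)) volume a b := fun a b => by
    have := ((hφ.add_arg (x - c)).ii a b).mul_continuousOn (g := fun u => Real.sin (n*u)) (by fun_prop)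
    refine IntervalIntegrable.congr (fun u _ => ?_) this
    show φ (u + (x - c)) * _ = φ (x - c + u) * _
    rw [add_comm u]
  have e3 : ∀ u, φ (x - (u + c)) * (-(-1)^k * Real.sin (n*u)) = (-(-1)^k) * (φ (x - c - u) * Real.sin (n*u)) := by
    intro u; rw [show x - (u+c) = x - c - u by ring]; ring
  simp only [e3, intervalIntegral.integral_const_mul, sub_mul]
  congr 1
  rw [intervalIntegral.integral_sub (hi _ _) (hi2 _ _),
    ← intervalIntegral.integral_add_adjacent_intervals (hi (-b) 0) (hi 0 b)]
  have : ∫ u in (0:ℝ)..b, φ (x - c + u) * Real.sin (n*u) = - ∫ u in (-b)..0, φ (x - c - u) * Real.sin (n*u) := by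
    have := intervalIntegral.integral_comp_neg (a := 0) (b := b) (fun u => φ (x - c - u) * Real.sin (n*u))
    rw [neg_zero] at this
    rw [← this, ← intervalIntegral.integral_neg]
    refine intervalIntegral.integral_congr fun u _ => ?_
    simp [mul_neg, Real.sin_neg]
  rw [this]; ring

lemma upper_core {φ ω : ℝ → ℝ} (hφ : PerL1 φ) (hω : GoodMod ω)
    (hW : ∀ t, 0 ≤ t → ∫ x in (-π)..π, |φ (x + t) - φ x| ≤ ω t) {n : ℕ} (hn : 1 ≤ n)
    {Ψ G Q R : ℝ → ℝ} (hΨ : Continuous Ψ) (hG : Continuous G) (hR : Continuous R)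
    (hGp : Function.Periodic G (2*π)) (hG0 : ∀ t, 0 ≤ G t) (hQ : IsTrigPoly n Q) (β' : ℝ)
    (hdec : ∀ t, Ψ t = Real.cos (n * t - β') * G t + Q t - R t) (V : ℕ → ℝ)
    (hV : ∀ k < 2*n, ∀ s ∈ Set.Icc ((β' + k * π)/n) ((β' + (k+1:ℕ) * π)/n),
      ∀ t ∈ Set.Icc ((β' + k * π)/n) ((β' + (k+1:ℕ) * π)/n), |G t - G s| ≤ V k)
    {S : ℝ} (hS : ∑ k ∈ Finset.range (2*n), V k ≤ S) :
    IntervalIntegrable (fun x => ∫ t in (-π)..π, φ (x - t) * Ψ t) volume (-π) π ∧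
    ∃ T, IsTrigPoly n T ∧ ∫ x in (-π)..π, |(∫ t in (-π)..π, φ (x - t) * Ψ t) - T x| ≤
      ((∫ t in (-π)..π, G t)/π + S/n) * eN n ω + 14 * ω (1/n) * (S * π / n + ∫ t in (-π)..π, |R t|) := by
  have hn' : (1:ℝ) ≤ n := by exact_mod_cast hn
  have hn0 : (n:ℝ) ≠ 0 := by positivity
  have p0 := pi_pos
  have hpi : -π ≤ π := by linarith
  have hfi := (young hφ hΨ hpi).1
  refine ⟨hfi, ?_⟩
  obtain ⟨P, hP, hPn⟩ := jackson hφ hω hW hn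
  have hP1 := hP.perL1
  have hφ1 := hφ.sub hP1
  obtain ⟨φ1, hφ1e⟩ : ∃ φ1 : ℝ → ℝ, φ1 = fun x => φ x - P x := ⟨_, rfl⟩
  rw [← hφ1e] at hφ1 hPn
  have hφs : ∀ x, φ x = φ1 x + P x := fun x => by rw [hφ1e]; ring
  obtain ⟨y, hy⟩ : ∃ y : ℕ → ℝ, ∀ k : ℕ, y k = (β' + k * π)/n := ⟨_, fun _ => rfl⟩
  obtain ⟨c, hc⟩ : ∃ c : ℕ → ℝ, ∀ k : ℕ, c k = (β' + π/2 + k * π)/n := ⟨_, fun _ => rfl⟩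
  obtain ⟨g, hg⟩ : ∃ g : ℝ → ℝ, ∀ t, g t = Real.cos (n * t - β') := ⟨_, fun _ => rfl⟩
  have hgc : Continuous g := by rw [show g = _ from funext hg]; fun_prop
  have hg1 : ∀ t, |g t| ≤ 1 := fun t => by rw [hg]; exact Real.abs_cos_le_one _
  have hgp : Function.Periodic g (2*π) := fun t => by
    rw [hg, hg, show (n:ℝ) * (t + 2*π) - β' = n * t - β' + n * (2*π) by ring, Real.cos_add_nat_mul_two_pi]
  simp only [← hg] at hdec
  simp only [← hy] at hV
  have hlen : ∀ k, y (k+1) - y k = π / n := fun k => by rw [hy, hy]; push_cast; field_simp; ring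
  have hyle : ∀ k, y k ≤ y (k+1) := fun k => by
    have := hlen k; have : 0 < π/n := by positivity
    linarith
  have hyend : y (2*n) = y 0 + 2*π := by rw [hy, hy]; push_cast; field_simp; ring
  have hcm : ∀ k, c k ∈ Set.Icc (y k) (y (k+1)) := fun k => by
    have e1 : c k - y k = π/(2*n) := by rw [hc, hy]; field_simp; ring
    have e2 : y (k+1) - c k = π/(2*n) := by rw [hc, hy]; push_cast; field_simp; ring
    have : 0 < π/(2*n) := by positivity
    constructor <;> linarith
  obtain ⟨D, hD⟩ : ∃ D : ℕ → ℝ → ℝ, ∀ k x, D k x = ∫ u in (0:ℝ)..(π/(2*n)),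
      (φ (x - c k - u) - φ (x - c k + u)) * Real.sin (n * u) := ⟨_, fun _ _ => rfl⟩
  obtain ⟨B, hB⟩ : ∃ B : ℕ → ℝ → ℝ, ∀ k x, B k x = ∫ t in (y k)..(y (k+1)), φ1 (x - t) * (g t * (G t - G (c k))) :=
    ⟨_, fun _ _ => rfl⟩
  obtain ⟨C, hC⟩ : ∃ C : ℝ → ℝ, ∀ x, C x = ∫ t in (-π)..π, φ1 (x - t) * R t := ⟨_, fun _ => rfl⟩
  have hT : IsTrigPoly n (fun x => ((∫ t in (-π)..π, P (x - t) * Ψ t) -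
      ∑ k ∈ Finset.range (2*n), G (c k) * ∫ t in (y k)..(y (k+1)), P (x - t) * g t) +
      ∫ t in (-π)..π, φ1 (x - t) * Q t) :=
    ((hP.conv_left hΨ _ _).sub (IsTrigPoly.sum _ fun k _ => (hP.conv_left hgc _ _).cmul _)).add
      (hQ.conv_right hφ1)
  refine ⟨_, hT, ?_⟩
  have hDk : ∀ k x, ∫ t in (y k)..(y (k+1)), φ (x - t) * g t = (-(-1)^k) * D k x := by
    intro k x
    rw [hD, hc, hy, hy]; simp only [hg]
    exact cell_diff hφ n hn β' k x
  have hQc := hQ.continuous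
  have ident : ∀ x, (∫ t in (-π)..π, φ (x - t) * Ψ t) - (((∫ t in (-π)..π, P (x - t) * Ψ t) -
      ∑ k ∈ Finset.range (2*n), G (c k) * ∫ t in (y k)..(y (k+1)), P (x - t) * g t) +
      ∫ t in (-π)..π, φ1 (x - t) * Q t) =
      ∑ k ∈ Finset.range (2*n), (G (c k) * ((-(-1)^k) * D k x) + B k x) - C x := by
    intro x
    have i1 : ∫ t in (-π)..π, φ (x - t) * Ψ t = (∫ t in (-π)..π, φ1 (x - t) * Ψ t) +
        ∫ t in (-π)..π, P (x - t) * Ψ t := by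
      rw [← intervalIntegral.integral_add (hφ1.mul_cont hΨ _ _ _) (hP1.mul_cont hΨ _ _ _)]
      refine intervalIntegral.integral_congr fun t _ => ?_
      simp only [hφs]; ring
    have i2 : ∫ t in (-π)..π, φ1 (x - t) * Ψ t = (∫ t in (-π)..π, φ1 (x - t) * (g t * G t)) +
        (∫ t in (-π)..π, φ1 (x - t) * Q t) - C x := by
      rw [hC, ← intervalIntegral.integral_add (hφ1.mul_cont (by fun_prop) _ _ _) (hφ1.mul_cont hQc _ _ _),
        ← intervalIntegral.integral_sub ((hφ1.mul_cont (by fun_prop) _ _ _).add (hφ1.mul_cont hQc _ _ _))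
          (hφ1.mul_cont hR _ _ _)]
      refine intervalIntegral.integral_congr fun t _ => ?_
      simp only [hdec]; ring
    have i3 : ∫ t in (-π)..π, φ1 (x - t) * (g t * G t) =
        ∑ k ∈ Finset.range (2*n), ∫ t in (y k)..(y (k+1)), φ1 (x - t) * (g t * G t) := by
      rw [intervalIntegral.sum_integral_adjacent_intervals (fun k _ => hφ1.mul_cont (by fun_prop) _ _ _),
        hyend, per_int]
      intro t
      simp only [hgp t, hGp t]
      rw [← hφ1.2 (x - (t + 2*π))]; ring_nf
    have i4 : ∀ k, ∫ t in (y k)..(y (k+1)), φ1 (x - t) * (g t * G t) =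
        G (c k) * ((-(-1)^k) * D k x) + B k x - G (c k) * ∫ t in (y k)..(y (k+1)), P (x - t) * g t := by
      intro k
      rw [← hDk, hB, ← intervalIntegral.integral_const_mul, ← intervalIntegral.integral_const_mul,
        ← intervalIntegral.integral_add ((hφ.mul_cont hgc _ _ _).const_mul _) (hφ1.mul_cont (by fun_prop) _ _ _),
        ← intervalIntegral.integral_sub (((hφ.mul_cont hgc _ _ _).const_mul _).add (hφ1.mul_cont (by fun_prop) _ _ _))
          ((hP1.mul_cont hgc _ _ _).const_mul _)]
      refine intervalIntegral.integral_congr fun t _ => ?_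
      simp only [hφs]; ring
    rw [i1, i2, i3]
    simp only [i4, Finset.sum_sub_distrib]
    ring
  simp only [ident]
  have w0 := hω.2.2.2.2 (1/n)
  -- individual bounds
  have dB : ∀ k, IntervalIntegrable (D k) volume (-π) π ∧ ∫ x in (-π)..π, |D k x| ≤ eN n ω / n := by
    intro k
    have := young_diff hφ (q := fun u => Real.sin (n*u)) (by fun_prop) (b := π/(2*n)) (by positivity) (c k)
      (fun t ht => Real.sin_nonneg_of_nonneg_of_le_pi (by have := ht.1; positivity) (by
        have h2 : n * t ≤ n * (π/(2*n)) := by have := ht.2; gcongr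
        rw [show (n:ℝ) * (π/(2*n)) = π/2 by field_simp] at h2
        linarith)) hω.1 hW
    rw [eN_scale n hn] at this
    simpa only [← hD] using this
  have bB : ∀ k < 2*n, IntervalIntegrable (B k) volume (-π) π ∧ ∫ x in (-π)..π, |B k x| ≤ 14 * ω (1/n) * (V k * (π/n)) := by
    intro k hk
    have := young hφ1 (q := fun t => g t * (G t - G (c k))) (by fun_prop) (hyle k)
    simp only [← hB] at this
    refine ⟨this.1, this.2.trans ?_⟩
    refine mul_le_mul hPn ?_ (intervalIntegral.integral_nonneg (hyle k) fun _ _ => abs_nonneg _) (by positivity)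
    calc _ ≤ ∫ t in (y k)..(y (k+1)), V k := by
          refine intervalIntegral.integral_mono_on (hyle k) (Continuous.intervalIntegrable (by fun_prop) _ _)
            (by simp) fun t ht => ?_
          rw [abs_mul]
          exact (mul_le_of_le_one_left (abs_nonneg _) (hg1 t)).trans (hV k hk _ (hcm k) t ht)
      _ = _ := by rw [intervalIntegral.integral_const, hlen, smul_eq_mul, mul_comm]
  have cB : IntervalIntegrable C volume (-π) π ∧ ∫ x in (-π)..π, |C x| ≤ 14 * ω (1/n) * ∫ t in (-π)..π, |R t| := by
    have := young hφ1 hR hpi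
    simp only [← hC] at this
    exact ⟨this.1, this.2.trans (mul_le_mul_of_nonneg_right hPn
      (intervalIntegral.integral_nonneg hpi fun _ _ => abs_nonneg _))⟩
  have sG : (∑ k ∈ Finset.range (2*n), G (c k)) / n ≤ (∫ t in (-π)..π, G t)/π + S/n := by
    have h1 : ∫ t in (-π)..π, G t = ∑ k ∈ Finset.range (2*n), ∫ t in (y k)..(y (k+1)), G t := by
      rw [intervalIntegral.sum_integral_adjacent_intervals (fun k _ => hG.intervalIntegrable _ _),
        hyend, per_int hGp]
    have h2 : ∀ k < 2*n, (G (c k) - V k) * (π/n) ≤ ∫ t in (y k)..(y (k+1)), G t := by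
      intro k hk
      calc (G (c k) - V k) * (π/n) = ∫ t in (y k)..(y (k+1)), (G (c k) - V k) := by
            rw [intervalIntegral.integral_const, hlen, smul_eq_mul, mul_comm]
        _ ≤ _ := by
          refine intervalIntegral.integral_mono_on (hyle k) (by simp) (hG.intervalIntegrable _ _) fun t ht => ?_
          have := (abs_le.1 (hV k hk _ (hcm k) t ht)).1
          linarith
    have h3 : (∑ k ∈ Finset.range (2*n), G (c k) - S) * (π/n) ≤ ∫ t in (-π)..π, G t := by
      rw [h1]
      refine le_trans ?_ (Finset.sum_le_sum fun k hk => h2 k (Finset.mem_range.1 hk))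
      rw [← Finset.sum_mul, Finset.sum_sub_distrib]
      gcongr
    have h4 : (∑ k ∈ Finset.range (2*n), G (c k) - S) / n ≤ (∫ t in (-π)..π, G t) / π := by
      rw [le_div_iff₀ p0]
      calc _ = (∑ k ∈ Finset.range (2*n), G (c k) - S) * (π/n) := by ring
        _ ≤ _ := h3
    rw [sub_div] at h4
    linarith
  have e0 : 0 ≤ eN n ω := by
    unfold eN
    refine intervalIntegral.integral_nonneg (by positivity) fun t ht => mul_nonneg (hω.2.2.2.2 _) ?_
    exact Real.sin_nonneg_of_nonneg_of_le_pi ht.1 (by linarith [ht.2])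
  have hDi : ∀ k, IntervalIntegrable (fun x => |D k x|) volume (-π) π := fun k => (dB k).1.abs
  have hsumi : IntervalIntegrable (fun x => ∑ k ∈ Finset.range (2*n), (G (c k) * |D k x| + |B k x|)) volume (-π) π := by
    have := IntervalIntegrable.sum (Finset.range (2*n)) (f := fun k x => G (c k) * |D k x| + |B k x|)
      (fun k hk => ((hDi k).const_mul _).add (bB k (Finset.mem_range.1 hk)).1.abs)
    refine IntervalIntegrable.congr (fun x _ => ?_) this
    simp only [Finset.sum_apply]
  have hsumi2 : IntervalIntegrable (fun x => ∑ k ∈ Finset.range (2*n), (G (c k) * ((-(-1)^k) * D k x) + B k x)) volume (-π) π := by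
    have := IntervalIntegrable.sum (Finset.range (2*n)) (f := fun k x => G (c k) * ((-(-1)^k) * D k x) + B k x)
      (fun k hk => (((dB k).1.const_mul _).const_mul _).add (bB k (Finset.mem_range.1 hk)).1)
    refine IntervalIntegrable.congr (fun x _ => ?_) this
    simp only [Finset.sum_apply]
  calc _ ≤ ∫ x in (-π)..π, (∑ k ∈ Finset.range (2*n), (G (c k) * |D k x| + |B k x|) + |C x|) := by
        refine intervalIntegral.integral_mono_on hpi (hsumi2.sub cB.1).abs (hsumi.add cB.1.abs) fun x _ => ?_
        refine (abs_sub _ _).trans ?_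
        gcongr
        refine (Finset.abs_sum_le_sum_abs _ _).trans (Finset.sum_le_sum fun k _ => ?_)
        refine (abs_add_le _ _).trans ?_
        rw [abs_mul, abs_mul, abs_of_nonneg (hG0 _), abs_neg, abs_pow, abs_neg, abs_one, one_pow, one_mul]
    _ = ∑ k ∈ Finset.range (2*n), (G (c k) * (∫ x in (-π)..π, |D k x|) + ∫ x in (-π)..π, |B k x|) +
        ∫ x in (-π)..π, |C x| := by
        rw [intervalIntegral.integral_add hsumi cB.1.abs, intervalIntegral.integral_finsetSum]
        · congr 1
          refine Finset.sum_congr rfl fun k hk => ?_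
          rw [intervalIntegral.integral_add ((hDi k).const_mul _) (bB k (Finset.mem_range.1 hk)).1.abs,
            intervalIntegral.integral_const_mul]
        · exact fun k hk => ((hDi k).const_mul _).add (bB k (Finset.mem_range.1 hk)).1.abs
    _ ≤ ∑ k ∈ Finset.range (2*n), (G (c k) * (eN n ω / n) + 14 * ω (1/n) * (V k * (π/n))) +
        14 * ω (1/n) * ∫ t in (-π)..π, |R t| := by
        refine add_le_add (Finset.sum_le_sum fun k hk => add_le_add
          (mul_le_mul_of_nonneg_left (dB k).2 (hG0 _)) (bB k (Finset.mem_range.1 hk)).2) cB.2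
    _ = (∑ k ∈ Finset.range (2*n), G (c k)) / n * eN n ω + 14 * ω (1/n) * ((∑ k ∈ Finset.range (2*n), V k) * (π/n)
        + ∫ t in (-π)..π, |R t|) := by
        rw [Finset.sum_add_distrib, ← Finset.sum_mul, ← Finset.mul_sum, ← Finset.sum_mul]; ring
    _ ≤ _ := by
        rw [mul_div_assoc S π n]
        gcongr

lemma seq2_psi {ψ η : ℝ → ℝ} (h : IsMInfPlus ψ η) {n : ℕ} (hn : 1 ≤ n) : Seq2 (fun j : ℕ => ψ ((n:ℝ) + j)) := by
  have hn' : (1:ℝ) ≤ n := by exact_mod_cast hn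
  refine ⟨fun j => (h.1 _ (by linarith [j.cast_nonneg (α := ℝ)])).le, psi_summable h hn, fun j => ?_⟩
  have j0 := j.cast_nonneg (α := ℝ)
  obtain ⟨-, hcv⟩ := h.2.2.1
  have := hcv (show (n:ℝ) + j ∈ Set.Ici 1 from Set.mem_Ici.2 (by linarith))
    (show (n:ℝ) + (j+2:ℕ) ∈ Set.Ici 1 from Set.mem_Ici.2 (by push_cast; linarith))
    (show (0:ℝ) ≤ 1/2 by norm_num) (show (0:ℝ) ≤ 1/2 by norm_num) (by norm_num)
  simp only [smul_eq_mul] at this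
  push_cast at this ⊢
  rw [show 1/2 * ((n:ℝ) + j) + 1/2 * (n + (j + 2)) = n + (j + 1) by ring] at this
  linarith

lemma psi_pos' {ψ η : ℝ → ℝ} (h : IsMInfPlus ψ η) (k : ℕ) : 0 < ψ ((k:ℝ)+1) :=
  h.1 _ (by linarith [k.cast_nonneg (α := ℝ)])

lemma psi_summable1 {ψ η : ℝ → ℝ} (h : IsMInfPlus ψ η) : Summable (fun k : ℕ => ψ ((k:ℝ) + 1)) := by
  have := psi_summable0 h (le_refl 1)
  refine this.congr fun k => by rw [Nat.cast_one, add_comm]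

lemma PsiKer_summable {ψ η : ℝ → ℝ} (h : IsMInfPlus ψ η) (β t : ℝ) :
    Summable (fun k : ℕ => ψ (k + 1) * Real.cos ((k + 1) * t - β * π / 2)) := by
  refine Summable.of_norm_bounded (psi_summable1 h) fun j => ?_
  rw [Real.norm_eq_abs, abs_mul, abs_of_nonneg (psi_pos' h j).le]
  exact mul_le_of_le_one_right (psi_pos' h j).le (Real.abs_cos_le_one _)

lemma PsiKer_cont {ψ η : ℝ → ℝ} (h : IsMInfPlus ψ η) (β : ℝ) : Continuous (PsiKer ψ β) := by
  refine continuous_tsum (fun j => by fun_prop) (psi_summable1 h) fun j t => ?_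
  rw [Real.norm_eq_abs, abs_mul, abs_of_nonneg (psi_pos' h j).le]
  exact mul_le_of_le_one_right (psi_pos' h j).le (Real.abs_cos_le_one _)

lemma PsiKer_dec {ψ η : ℝ → ℝ} (h : IsMInfPlus ψ η) (β : ℝ) {n : ℕ} (hn : 1 ≤ n) :
    ∃ Q, IsTrigPoly n Q ∧ ∀ t, PsiKer ψ β t = Real.cos (n * t - β * π / 2) * GG (fun j : ℕ => ψ ((n:ℝ) + j)) t
      + Q t - TailF (fun i : ℕ => ψ (((3*n:ℕ):ℝ) + i)) n (β * π / 2) t := by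
  have hn' : (1:ℝ) ≤ n := by exact_mod_cast hn
  have hs2 := seq2_psi h hn
  obtain ⟨m, rfl⟩ : ∃ m, n = m + 1 := ⟨n - 1, by omega⟩
  obtain ⟨u, hu⟩ : ∃ u : ℝ → ℕ → ℝ, ∀ t j, u t j = if j = 0 then 0 else ψ (((m+1:ℕ):ℝ) + j) *
    Real.cos (((j:ℤ) - ((m+1:ℕ):ℤ) : ℤ) * t + β * π / 2) := ⟨_, fun _ _ => rfl⟩
  refine ⟨fun t => ∑ k ∈ Finset.range m, ψ (k + 1) * Real.cos ((k + 1) * t - β * π / 2) -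
    ∑ j ∈ Finset.range (2*(m+1)), u t j, ?_, fun t => ?_⟩
  · refine IsTrigPoly.sub (IsTrigPoly.sum _ fun k hk => IsTrigPoly.cmul ?_ _) (IsTrigPoly.sum _ fun j hj => ?_)
    · have := IsTrigPoly.cos (n := m+1) (k := k+1) (by simp at hk; omega) (-(β * π / 2))
      push_cast at this
      exact this
    · simp only [hu]
      split_ifs with h0
      · exact IsTrigPoly.zero
      · refine IsTrigPoly.cmul (IsTrigPoly.cos_int ?_ _) _
        simp at hj
        rw [abs_lt]; push_cast; omega
  · have hus : Summable (u t) := by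
      refine Summable.of_norm_bounded hs2.summable fun j => ?_
      rw [hu, Real.norm_eq_abs]
      split_ifs
      · simpa using hs2.nn j
      · rw [abs_mul, abs_of_nonneg (hs2.nn j)]
        exact mul_le_of_le_one_right (hs2.nn j) (Real.abs_cos_le_one _)
    have hsh := PsiKer_summable h β t
    have e1 : PsiKer ψ β t = _ := (hsh.sum_add_tsum_nat_add m).symm
    have e2 := hus.sum_add_tsum_nat_add (2*(m+1))
    have e3 : TailF (fun i : ℕ => ψ (((3*(m+1):ℕ):ℝ) + i)) (m+1) (β * π / 2) t = ∑' i, u t (i + 2*(m+1)) := by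
      unfold TailF
      refine tsum_congr fun i => ?_
      rw [hu, if_neg (by omega)]
      push_cast
      congr 2 <;> ring_nf
    have e4 : Real.cos (((m+1:ℕ):ℝ) * t - β * π / 2) * GG (fun j : ℕ => ψ (((m+1:ℕ):ℝ) + j)) t =
       (∑' i : ℕ, ψ ((i + m : ℕ) + 1) * Real.cos (((i + m : ℕ) + 1) * t - β * π / 2)) + ∑' j, u t j := by
      unfold GG
      rw [← tsum_mul_left, ← Summable.tsum_add ((summable_nat_add_iff m).2 hsh) hus]
      refine tsum_congr fun j => ?_
      rw [hu]; unfold bq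
      push_cast
      split_ifs with h0
      · subst h0; simp; rw [mul_comm]
      · rw [show (j:ℝ) + m + 1 = m + 1 + j by ring,
          show ((m:ℝ) + 1 + j) * t - β * π / 2 = ((m+1) * t - β * π/2) + j * t by ring,
          show ((j:ℝ) - (m+1)) * t + β * π / 2 = j * t - ((m+1) * t - β * π/2) by ring]
        generalize ((m:ℝ)+1) * t - β * π/2 = A
        rw [Real.cos_add A, Real.cos_sub _ A]
        ring
    rw [e1, e3, e4]
    linarith

lemma eN_nonneg {n : ℕ} {ω : ℝ → ℝ} (hω : GoodMod ω) : 0 ≤ eN n ω := by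
  unfold eN
  refine intervalIntegral.integral_nonneg (by positivity) fun t ht => mul_nonneg (hω.2.2.2.2 _) ?_
  exact Real.sin_nonneg_of_nonneg_of_le_pi ht.1 (by linarith [ht.2, pi_pos])

lemma omega_pi {n : ℕ} (hn : 1 ≤ n) {ω : ℝ → ℝ} (hω : GoodMod ω) : ω (π/n) ≤ 5 * ω (1/n) := by
  have hn' : (1:ℝ) ≤ n := by exact_mod_cast hn
  have := hω.scale (x := π) (s := 1/n) pi_pos.le (by positivity)
  rw [mul_one_div] at this
  have w := hω.2.2.2.2 (1/n)
  nlinarith [Real.pi_lt_four]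

lemma eN_le {n : ℕ} (hn : 1 ≤ n) {ω : ℝ → ℝ} (hω : GoodMod ω) : eN n ω ≤ 5 * ω (1/n) := by
  have hn' : (1:ℝ) ≤ n := by exact_mod_cast hn
  have hωc := hω.1
  refine le_trans ?_ (omega_pi hn hω)
  have : ∫ t in (0:ℝ)..(π/2), ω (π/n) * Real.sin t = ω (π/n) := by
    rw [intervalIntegral.integral_const_mul, integral_sin]; simp
  rw [← this]
  unfold eN
  refine intervalIntegral.integral_mono_on (by positivity) (Continuous.intervalIntegrable (by fun_prop) _ _)
    (Continuous.intervalIntegrable (by fun_prop) _ _) fun t ht => ?_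
  refine mul_le_mul_of_nonneg_right (hω.2.1 ?_) (Real.sin_nonneg_of_nonneg_of_le_pi ht.1 (by linarith [ht.2, pi_pos]))
  have := ht.2
  gcongr; linarith

/-- the basic error quantity -/
def errQ (ψ η : ℝ → ℝ) (n : ℕ) : ℝ :=
  (∑' j : ℕ, ψ (((n+1:ℕ):ℝ) + j)) / n + ψ (3 * n) * (1 + max 0 (Real.log (η n - n)))

lemma upper {ψ η ω φ : ℝ → ℝ} (h : IsMInfPlus ψ η) (β : ℝ) {n : ℕ} (hn : 1 ≤ n)
    (hm : 2 ≤ (n:ℝ) / (η n - n)) (hω : GoodMod ω) (hφ : PerL1 φ)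
    (hW : ∀ t, 0 ≤ t → ∫ x in (-π)..π, |φ (x + t) - φ x| ≤ ω t) :
    IntervalIntegrable (fun x => ∫ t in (-π)..π, φ (x - t) * PsiKer ψ β t) volume (-π) π ∧
    ∃ T, IsTrigPoly n T ∧ ∫ x in (-π)..π, |(∫ t in (-π)..π, φ (x - t) * PsiKer ψ β t) - T x| ≤
      2 * ψ n * eN n ω + 10000 * errQ ψ η n * ω (1/n) := by
  have hn' : (1:ℝ) ≤ n := by exact_mod_cast hn
  have p0 := pi_pos
  have hs2 := seq2_psi h hn
  obtain ⟨Q, hQ, hdec⟩ := PsiKer_dec h β hn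
  obtain ⟨V, hV1, hV2⟩ := GG_var hs2 (2*n) (fun k : ℕ => (β * π / 2 + k * π)/n) (fun i j hij => by
    have : (i:ℝ) ≤ j := by exact_mod_cast hij
    simp only; gcongr) (by push_cast; field_simp; ring)
  have h3n : 1 ≤ 3 * n := by omega
  have hp : ∀ i : ℕ, 0 ≤ ψ (((3*n:ℕ):ℝ) + i) := (seq2_psi h h3n).nn
  have hps := psi_summable0 h h3n
  have h3n' : (1:ℝ) ≤ ((3*n:ℕ):ℝ) := by exact_mod_cast h3n
  have hpa : ∀ i : ℕ, ψ (((3*n:ℕ):ℝ) + (i+1:ℕ)) ≤ ψ (((3*n:ℕ):ℝ) + i) := fun i => by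
    have i0 := i.cast_nonneg (α := ℝ)
    refine psi_anti h (Set.mem_Ici.2 (by linarith)) (Set.mem_Ici.2 (by push_cast at *; linarith)) (by push_cast; linarith)
  have u := upper_core hφ hω hW hn (PsiKer_cont h β) (GG_cont hs2) (Tail_cont hp hps n (β*π/2)) (GG_per _)
    (GG_nonneg hs2) hQ _ hdec V hV1 hV2
  refine ⟨u.1, ?_⟩
  obtain ⟨T, hT, hle⟩ := u.2
  refine ⟨T, hT, hle.trans ?_⟩
  have heta := (h.2.2.2.2.1 n hn').1
  have tb := Tail_int hp hpa hps n (β*π/2) (x := η n - n) (by linarith) (by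
    have := psi_sum_bound h hn (N := 3*n) (by omega) hm
    simp only [Nat.cast_zero, add_zero]
    refine this.trans (le_of_eq ?_)
    push_cast
    rw [show 3 * (n:ℝ) / n = 3 by field_simp]; ring)
  rw [GG_int hs2]
  have es : ∑' j : ℕ, ψ ((n:ℝ) + (j+1:ℕ)) = ∑' j : ℕ, ψ (((n+1:ℕ):ℝ) + j) :=
    tsum_congr fun j => by push_cast; ring_nf
  rw [es]
  have S0 : 0 ≤ ∑' j : ℕ, ψ (((n+1:ℕ):ℝ) + j) := tsum_nonneg (seq2_psi h (by omega : 1 ≤ n+1)).nn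
  simp only [Nat.cast_zero, add_zero] at tb ⊢
  have e3 : ((3*n:ℕ):ℝ) = 3 * n := by push_cast; ring
  rw [e3] at tb
  unfold errQ
  simp only [e3]
  have ψ3 : 0 ≤ ψ (3*n) := by have := hp 0; simpa using this
  generalize hX : (∑' j : ℕ, ψ (((n+1:ℕ):ℝ) + j)) = X at *
  generalize hY : ψ (3 * n) * (1 + max 0 (Real.log (η n - n))) = Y at *
  have Y0 : 0 ≤ Y := by rw [← hY]; have := le_max_left 0 (Real.log (η n - n)); positivity
  have eb := eN_le hn hω
  have e0 := eN_nonneg (n := n) hω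
  have w0 := hω.2.2.2.2 (1/n)
  have hpi4 := Real.pi_lt_four
  have Z0 : 0 ≤ X / n := by positivity
  have a1 : (2 * π * ψ n / π + 8 * π * X / n) * eN n ω ≤ 2 * ψ n * eN n ω + 160 * (X/n) * ω (1/n) := by
    have : (2 * π * ψ n / π + 8 * π * X / n) * eN n ω = 2 * ψ n * eN n ω + 8 * π * (X / n) * eN n ω := by
      field_simp
    rw [this]
    have : 8 * π * (X / n) * eN n ω ≤ 8 * 4 * (X/n) * (5 * ω (1/n)) := by gcongr
    linarith
  have a2 : 14 * ω (1/n) * (8 * π * X * π / n + ∫ t in (-π)..π, |TailF (fun i : ℕ => ψ (3*n + i)) n (β*π/2) t|)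
      ≤ 14 * ω (1/n) * (128 * (X/n) + 208 * Y) := by
    have b1 : 8 * π * X * π / n ≤ 128 * (X/n) := by
      have : 8 * π * X * π / n = 8 * (π * π) * (X/n) := by ring
      rw [this]
      have : π * π ≤ 16 := by nlinarith
      nlinarith
    have b2 : 52 * π * Y ≤ 208 * Y := by nlinarith
    gcongr
    linarith
  refine (add_le_add a1 a2).trans ?_
  have m1 := mul_nonneg Z0 w0
  have m2 := mul_nonneg Y0 w0
  nlinarith

lemma per_small {g : ℝ → ℝ} {n : ℕ} (hn : 1 ≤ n) (hp : Function.Periodic g (π/n))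
    (hi : ∀ a b, IntervalIntegrable g volume a b) (a : ℝ) :
    ∫ x in (-π)..π, g x = 2 * n * ∫ x in a..(a + π/n), g x := by
  have hn' : (1:ℝ) ≤ n := by exact_mod_cast hn
  have h1 := hp.intervalIntegral_add_zsmul_eq (2*n) (-π) hi
  rw [hp.intervalIntegral_add_eq a (-π)]
  simp only [zsmul_eq_mul] at h1
  push_cast at h1
  rw [← h1]; congr 1; field_simp; ring

lemma per_even {g : ℝ → ℝ} {n : ℕ} (hn : 1 ≤ n) (hp : Function.Periodic g (π/n)) (he : ∀ x, g (-x) = g x)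
    (hi : ∀ a b, IntervalIntegrable g volume a b) :
    ∫ x in (-π)..π, g x = 4 * n * ∫ x in (0:ℝ)..(π/(2*n)), g x := by
  have hn' : (1:ℝ) ≤ n := by exact_mod_cast hn
  rw [per_small hn hp hi (-(π/(2*n))), show -(π/(2*n)) + π/n = π/(2*n) by field_simp; ring,
    ← intervalIntegral.integral_add_adjacent_intervals (hi _ 0) (hi 0 _)]
  have := intervalIntegral.integral_comp_neg (a := 0) (b := π/(2*n)) g
  simp only [he, neg_zero] at this
  rw [← this]; ring

lemma extremal {d : ℝ → ℝ} (hd : Continuous d) (hd0 : ∀ u, 0 ≤ u → 0 ≤ d u) (hda : AntitoneOn d (Set.Ici 0))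
    {n : ℕ} (hn : 1 ≤ n) : ∃ φ : ℝ → ℝ, PerL1 φ ∧ (∀ x, φ (-x) = φ x) ∧ (∀ x, φ (x + π/n) = - φ x) ∧
      norm1 φ = ∫ u in (0:ℝ)..(π/(2*n)), d u ∧
      (∫ x in (-π)..π, φ x * Real.cos (n*x)) = ∫ u in (0:ℝ)..(π/(2*n)), d u * Real.cos (n*u) ∧
      ∀ h, 0 ≤ h → h ≤ π/n → ∫ x in (-π)..π, |φ (x+h) - φ x| ≤ 2 * ∫ u in (0:ℝ)..(h/2), d u := by
  have hn' : (1:ℝ) ≤ n := by exact_mod_cast hn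
  have hn0 : (n:ℝ) ≠ 0 := by positivity
  have p0 := pi_pos
  obtain ⟨E, hE⟩ : ∃ E : ℝ → ℝ, ∀ c, E c = d (Real.arccos c / n) / (4*n) := ⟨_, fun _ => rfl⟩
  have hE0 : ∀ c, 0 ≤ E c := fun c => by
    rw [hE]; exact div_nonneg (hd0 _ (div_nonneg (Real.arccos_nonneg c) (by positivity))) (by positivity)
  have hEm : Monotone E := fun a b hab => by
    rw [hE, hE]
    refine div_le_div_of_nonneg_right (hda ?_ ?_ ?_) (by positivity)
    · exact div_nonneg (Real.arccos_nonneg _) (by positivity)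
    · exact div_nonneg (Real.arccos_nonneg _) (by positivity)
    · exact div_le_div_of_nonneg_right (Real.arccos_le_arccos hab) (by positivity)
  obtain ⟨H, hH⟩ : ∃ H : ℝ → ℝ, ∀ c, H c = if 0 < c then E c else if c < 0 then - E (-c) else 0 := ⟨_, fun _ => rfl⟩
  have hHo : ∀ c, H (-c) = - H c := fun c => by
    rw [hH, hH]
    rcases lt_trichotomy c 0 with h | h | h
    · simp [h, h.not_gt]
    · simp [h]
    · simp [h, h.not_gt]
  have hHm : Monotone H := fun a b hab => by
    have A := hE0 a
    have B := hE0 b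
    have A' := hE0 (-a)
    have B' := hE0 (-b)
    have M1 := hEm hab
    have M2 := hEm (neg_le_neg hab)
    rw [hH, hH]
    split_ifs <;> linarith
  obtain ⟨φ, hφ⟩ : ∃ φ : ℝ → ℝ, ∀ x, φ x = H (Real.cos (n*x)) := ⟨_, fun _ => rfl⟩
  have hanti : ∀ x, φ (x + π/n) = - φ x := fun x => by
    rw [hφ, hφ, show (n:ℝ) * (x + π/n) = n*x + π by field_simp, Real.cos_add_pi, hHo]
  have heven : ∀ x, φ (-x) = φ x := fun x => by rw [hφ, hφ, mul_neg, Real.cos_neg]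
  have hper : Function.Periodic φ (2*π) := fun x => by
    rw [hφ, hφ, mul_add, Real.cos_add_nat_mul_two_pi]
  have hmeas : Measurable φ := by
    rw [show φ = _ from funext hφ]; exact hHm.measurable.comp (by fun_prop)
  have hbd : ∀ x, |φ x| ≤ H 1 := fun x => by
    rw [hφ, abs_le, ← hHo]
    exact ⟨hHm (Real.neg_one_le_cos _), hHm (Real.cos_le_one _)⟩
  have hbi : ∀ {f : ℝ → ℝ} (C : ℝ), Measurable f → (∀ x, |f x| ≤ C) → ∀ a b, IntervalIntegrable f volume a b := by
    intro f C hf hb a b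
    refine (intervalIntegrable_const (c := C)).mono_fun' hf.aestronglyMeasurable ?_
    exact Eventually.of_forall fun x => hb x
  have hi := hbi _ hmeas hbd
  have hP : PerL1 φ := ⟨hi _ _, hper⟩
  have hval : ∀ x, 0 ≤ x → x < π/(2*n) → φ x = d x / (4*n) := by
    intro x hx hx2
    have h1 : n * x < π/2 := by
      calc (n:ℝ) * x < n * (π/(2*n)) := by gcongr
        _ = π/2 := by field_simp
    have h0 : 0 ≤ (n:ℝ) * x := by positivity
    rw [hφ, hH, if_pos (Real.cos_pos_of_mem_Ioo ⟨by linarith, h1⟩), hE, Real.arccos_cos h0 (by linarith)]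
    congr 2; field_simp
  have hcong : ∀ (F : ℝ → ℝ → ℝ) (b : ℝ), 0 ≤ b → b ≤ π/(2*n) →
      ∫ x in (0:ℝ)..b, F (φ x) x = ∫ x in (0:ℝ)..b, F (d x / (4*n)) x := by
    intro F b hb hb2
    refine intervalIntegral.integral_congr_ae ?_
    filter_upwards [Measure.ae_ne volume (π/(2*n))] with x hx hxm
    rw [Set.uIoc_of_le hb] at hxm
    rw [hval x hxm.1.le (lt_of_le_of_ne (hxm.2.trans hb2) hx)]
  have hb0 : 0 ≤ π/(2*n) := by positivity
  refine ⟨φ, hP, heven, hanti, ?_, ?_, ?_⟩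
  · unfold norm1
    rw [per_even hn (fun x => by simp only [hanti x, abs_neg]) (fun x => by simp only [heven]) (fun a b => (hi a b).abs),
      hcong (fun y _ => |y|) _ hb0 le_rfl, ← intervalIntegral.integral_const_mul]
    refine intervalIntegral.integral_congr fun x hx => ?_
    rw [Set.uIcc_of_le hb0] at hx
    rw [abs_of_nonneg (div_nonneg (hd0 x hx.1) (by positivity))]; field_simp
  · rw [per_even hn (fun x => by
        simp only [hanti x]
        rw [show (n:ℝ) * (x + π/n) = n*x + π by field_simp, Real.cos_add_pi]; ring)
      (fun x => by simp only [heven, mul_neg, Real.cos_neg])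
      (fun a b => (hi a b).mul_continuousOn (by fun_prop)),
      hcong (fun y x => y * Real.cos (n*x)) _ hb0 le_rfl, ← intervalIntegral.integral_const_mul]
    refine intervalIntegral.integral_congr fun x hx => ?_
    field_simp
  · intro h h0 hh
    have e1 : ∫ x in (-π)..π, |φ (x+h) - φ x| = ∫ x in (-π)..π, |φ (x+h/2) - φ (x-h/2)| := by
      have hp : Function.Periodic (fun x => |φ (x+h/2) - φ (x-h/2)|) (2*π) := fun x => by
        beta_reduce
        rw [show x + 2*π + h/2 = x + h/2 + 2*π by ring, show x + 2*π - h/2 = x - h/2 + 2*π by ring, hper, hper]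
      rw [← per_shift hp (h/2)]
      refine intervalIntegral.integral_congr fun x _ => ?_
      show _ = |φ (x + h/2 + h/2) - φ (x + h/2 - h/2)|
      congr 3 <;> ring
    have hi' : ∀ c a b, IntervalIntegrable (fun x => φ (x + c)) volume a b := fun c a b =>
      hbi _ (hmeas.comp (by fun_prop)) (fun x => hbd _) a b
    have hi'' : ∀ c a b, IntervalIntegrable (fun x => φ (x - c)) volume a b := fun c a b =>
      hbi _ (hmeas.comp (by fun_prop)) (fun x => hbd _) a b
    rw [e1, per_small hn (fun x => by
      rw [show x + π/n + h/2 = x + h/2 + π/n by ring, show x + π/n - h/2 = x - h/2 + π/n by ring, hanti, hanti,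
        neg_sub_neg, abs_sub_comm]) (fun a b => ((hi' _ a b).sub (hi'' _ a b)).abs) 0, zero_add]
    have e2 : ∫ x in (0:ℝ)..(π/n), |φ (x+h/2) - φ (x-h/2)| = ∫ x in (0:ℝ)..(π/n), (φ (x-h/2) - φ (x+h/2)) := by
      refine intervalIntegral.integral_congr fun x hx => ?_
      rw [Set.uIcc_of_le (by positivity)] at hx
      rw [abs_sub_comm, abs_of_nonneg]
      rw [hφ, hφ, sub_nonneg]
      refine hHm ?_
      rw [show (n:ℝ) * (x + h/2) = n*x + n*(h/2) by ring, show (n:ℝ) * (x - h/2) = n*x - n*(h/2) by ring,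
        Real.cos_add, Real.cos_sub]
      have s1 : 0 ≤ Real.sin (n*x) := Real.sin_nonneg_of_nonneg_of_le_pi (by have := hx.1; positivity) (by
        calc (n:ℝ) * x ≤ n * (π/n) := by have := hx.2; gcongr
          _ = π := by field_simp)
      have s2 : 0 ≤ Real.sin (n*(h/2)) := Real.sin_nonneg_of_nonneg_of_le_pi (by positivity) (by
        calc (n:ℝ) * (h/2) ≤ n * (π/n) := mul_le_mul_of_nonneg_left (by linarith) (by positivity)
          _ = π := by field_simp)
      have := mul_nonneg s1 s2
      linarith
    have e3 : ∫ x in (0:ℝ)..(π/n), (φ (x-h/2) - φ (x+h/2)) = (∫ x in (-(h/2))..(h/2), φ x) -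
        ∫ x in (-(h/2))..(h/2), φ (x + π/n) := by
      rw [intervalIntegral.integral_sub (hi'' _ _ _) (hi' _ _ _), intervalIntegral.integral_comp_sub_right (fun x => φ x),
        intervalIntegral.integral_comp_add_right (fun x => φ x), intervalIntegral.integral_comp_add_right (fun x => φ x)]
      have q1 := intervalIntegral.integral_add_adjacent_intervals (hi (-(h/2)) (h/2)) (hi (h/2) (π/n - h/2))
      have q2 := intervalIntegral.integral_add_adjacent_intervals (hi (h/2) (π/n - h/2)) (hi (π/n - h/2) (π/n + h/2))
      rw [zero_sub, zero_add, show -(h/2) + π/n = π/n - h/2 by ring, show h/2 + π/n = π/n + h/2 by ring, ← q1, ← q2]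
      ring
    simp only [hanti] at e3
    have e4 : ∫ x in (-(h/2))..(h/2), φ x = 2 * ∫ x in (0:ℝ)..(h/2), φ x := by
      rw [← intervalIntegral.integral_add_adjacent_intervals (hi _ 0) (hi 0 _)]
      have := intervalIntegral.integral_comp_neg (a := 0) (b := h/2) φ
      simp only [heven, neg_zero] at this
      rw [← this]; ring
    have e5 : ∫ x in (0:ℝ)..(h/2), φ x = (∫ x in (0:ℝ)..(h/2), d x) / (4*n) := by
      rw [hcong (fun y _ => y) _ (by positivity) (by
        calc h/2 ≤ (π/n)/2 := by gcongr
          _ = π/(2*n) := by field_simp), intervalIntegral.integral_div]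
    rw [e2, e3, intervalIntegral.integral_neg, e4, e5]
    refine le_of_eq ?_
    field_simp; ring

lemma alt_sum {n k : ℕ} (hk : k < n) (x α : ℝ) :
    ∑ l ∈ Finset.range (2*n), (-1:ℝ)^l * Real.cos (k * (x + l * (π/n)) + α) = 0 := by
  have hn0 : (0:ℝ) < n := by exact_mod_cast (by omega : 0 < n)
  have hkn : (k:ℝ) < n := by exact_mod_cast hk
  have k0 : (0:ℝ) ≤ k := k.cast_nonneg
  have p0 := pi_pos
  obtain ⟨θ, hθ⟩ : ∃ θ : ℝ, θ = (k + n) * π / n := ⟨_, rfl⟩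
  have e : ∀ l : ℕ, (-1:ℝ)^l * Real.cos (k * (x + l * (π/n)) + α) = Real.cos (k*x + α + l*θ) := by
    intro l
    rw [show (k:ℝ)*x + α + l*θ = (k * (x + l * (π/n)) + α) + l * π by rw [hθ]; field_simp; ring]
    rw [Real.cos_add_nat_mul_pi]
  simp only [e]
  have tel := Finset.sum_range_sub (fun l : ℕ => Real.sin (k*x + α - θ/2 + l*θ)) (2*n)
  have e2 : ∀ l : ℕ, Real.sin (k*x + α - θ/2 + (l+1:ℕ)*θ) - Real.sin (k*x + α - θ/2 + l*θ)
      = 2 * Real.sin (θ/2) * Real.cos (k*x + α + l*θ) := by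
    intro l
    rw [show k*x + α - θ/2 + (l+1:ℕ)*θ = (k*x + α + l*θ) + θ/2 by push_cast; ring,
      show k*x + α - θ/2 + l*θ = (k*x + α + l*θ) - θ/2 by ring, Real.sin_add, Real.sin_sub]; ring
  simp only [e2, ← Finset.mul_sum] at tel
  rw [show k*x + α - θ/2 + (2*n:ℕ)*θ = k*x + α - θ/2 + (k+n:ℕ)*(2*π) by rw [hθ]; push_cast; field_simp,
    Real.sin_add_nat_mul_two_pi] at tel
  have hs : 0 < Real.sin (θ/2) := by
    apply Real.sin_pos_of_pos_of_lt_pi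
    · rw [hθ]; positivity
    · rw [hθ, div_div, div_lt_iff₀ (by positivity)]; nlinarith
  have : 2 * Real.sin (θ/2) * ∑ l ∈ Finset.range (2*n), Real.cos (k*x + α + l*θ) = 0 := by
    rw [tel]; simp
  rcases mul_eq_zero.1 this with h | h
  · linarith
  · exact h

lemma alt_trig {n : ℕ} {T : ℝ → ℝ} (hT : IsTrigPoly n T) (x : ℝ) :
    ∑ l ∈ Finset.range (2*n), (-1:ℝ)^l * T (x + l * (π/n)) = 0 := by
  obtain ⟨a, b, h⟩ := hT
  simp only [h, Finset.mul_sum]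
  rw [Finset.sum_comm]
  refine Finset.sum_eq_zero fun k hk => ?_
  have hk := Finset.mem_range.1 hk
  have h1 := alt_sum hk x 0
  have h2 := alt_sum hk x (-(π/2))
  simp only [add_zero] at h1
  simp only [← sub_eq_add_neg, Real.cos_sub_pi_div_two] at h2
  calc _ = a k * (∑ l ∈ Finset.range (2*n), (-1:ℝ)^l * Real.cos (k * (x + l * (π/n)))) +
      b k * (∑ l ∈ Finset.range (2*n), (-1:ℝ)^l * Real.sin (k * (x + l * (π/n)))) := by
        rw [Finset.mul_sum, Finset.mul_sum, ← Finset.sum_add_distrib]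
        exact Finset.sum_congr rfl fun l _ => by ring
    _ = 0 := by rw [h1, h2]; ring

lemma int_abs_cos {n : ℕ} (hn : 1 ≤ n) (α : ℝ) : ∫ x in (-π)..π, |Real.cos (n*x - α)| = 4 := by
  have hn' : (1:ℝ) ≤ n := by exact_mod_cast hn
  have hc : ∀ a b, IntervalIntegrable (fun x : ℝ => |Real.cos (n*x)|) volume a b := fun a b =>
    (by fun_prop : Continuous fun x : ℝ => |Real.cos (n*x)|).intervalIntegrable _ _
  have hp : Function.Periodic (fun x : ℝ => |Real.cos (n*x)|) (π/n) := fun x => by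
    beta_reduce
    rw [show (n:ℝ) * (x + π/n) = n*x + π by field_simp, Real.cos_add_pi, abs_neg]
  have hp2 : Function.Periodic (fun x : ℝ => |Real.cos (n*x)|) (2*π) := fun x => by
    beta_reduce
    rw [mul_add, Real.cos_add_nat_mul_two_pi]
  have e1 := per_shift hp2 (-(α/n))
  have e2 : ∀ x : ℝ, (n:ℝ) * (x + -(α/n)) = n*x - α := fun x => by field_simp; ring
  simp only [e2] at e1
  rw [e1, per_even hn hp (fun x => by simp only [mul_neg, Real.cos_neg]) hc]
  have e3 : ∫ x in (0:ℝ)..(π/(2*n)), |Real.cos (n*x)| = ∫ x in (0:ℝ)..(π/(2*n)), Real.cos (n*x) := by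
    refine intervalIntegral.integral_congr fun x hx => ?_
    rw [Set.uIcc_of_le (by positivity)] at hx
    refine abs_of_nonneg (Real.cos_nonneg_of_neg_pi_div_two_le_of_le ?_ ?_)
    · have : 0 ≤ (n:ℝ) * x := mul_nonneg (by positivity) hx.1
      linarith [pi_pos]
    · calc (n:ℝ) * x ≤ n * (π/(2*n)) := mul_le_mul_of_nonneg_left hx.2 (by positivity)
        _ = π/2 := by field_simp
  rw [e3, intervalIntegral.integral_comp_mul_left (fun x => Real.cos x) (by positivity), integral_cos,
    show (n:ℝ) * (π/(2*n)) = π/2 by field_simp]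
  simp; field_simp

lemma cos_best {n : ℕ} (hn : 1 ≤ n) {T : ℝ → ℝ} (hT : IsTrigPoly n T) {c : ℝ} (hc : 0 ≤ c) (α : ℝ) :
    4 * c ≤ ∫ x in (-π)..π, |c * Real.cos (n*x - α) - T x| := by
  have hn' : (1:ℝ) ≤ n := by exact_mod_cast hn
  have hTc := hT.continuous
  have key : ∀ l : ℕ, ∫ x in (-π)..π, |c * Real.cos (n*x - α) - T x| =
      ∫ x in (-π)..π, |c * Real.cos (n*x - α) - (-1:ℝ)^l * T (x + l*(π/n))| := by
    intro l
    have hp : Function.Periodic (fun x => |c * Real.cos (n*x - α) - T x|) (2*π) := fun x => by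
      beta_reduce
      rw [hT.periodic, show (n:ℝ) * (x + 2*π) - α = n*x - α + n*(2*π) by ring, Real.cos_add_nat_mul_two_pi]
    rw [← per_shift hp (l*(π/n))]
    refine intervalIntegral.integral_congr fun x _ => ?_
    beta_reduce
    rw [show (n:ℝ) * (x + l*(π/n)) - α = n*x - α + l*π by field_simp; ring, Real.cos_add_nat_mul_pi]
    have s : ((-1:ℝ)^l) * (-1)^l = 1 := by rw [← mul_pow]; simp
    rw [show c * ((-1:ℝ)^l * Real.cos (n*x - α)) - T (x + l*(π/n)) =
      (-1:ℝ)^l * (c * Real.cos (n*x - α) - (-1:ℝ)^l * T (x + l*(π/n))) by linear_combination (T (x + l*(π/n))) * s]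
    rw [abs_mul, abs_pow]; simp
  have hsum : ∫ x in (-π)..π, |2*n*c * Real.cos (n*x - α)| ≤
      ∑ l ∈ Finset.range (2*n), ∫ x in (-π)..π, |c * Real.cos (n*x - α) - (-1:ℝ)^l * T (x + l*(π/n))| := by
    rw [← intervalIntegral.integral_finsetSum]
    · refine intervalIntegral.integral_mono_on (by linarith [pi_pos]) ?_ ?_ fun x _ => ?_
      · exact (by fun_prop : Continuous _).intervalIntegrable _ _
      · exact (by fun_prop : Continuous _).intervalIntegrable _ _
      · refine le_trans (le_of_eq ?_) (Finset.abs_sum_le_sum_abs _ _)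
        rw [Finset.sum_sub_distrib, alt_trig hT]
        simp; ring_nf
    · intro i _
      exact (by fun_prop : Continuous _).intervalIntegrable _ _
  simp only [← key] at hsum
  simp only [abs_mul (2*n*c), intervalIntegral.integral_const_mul, int_abs_cos hn, abs_of_nonneg (by positivity : 0 ≤ 2*n*c)] at hsum
  simp at hsum
  have : (0:ℝ) < 2*n := by positivity
  nlinarith

lemma sparse_sum {ψ η : ℝ → ℝ} (h : IsMInfPlus ψ η) {n : ℕ} (hn : 1 ≤ n) :
    Summable (fun m : ℕ => ψ (n * ((m:ℝ) + 2))) ∧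
    ∑' m : ℕ, ψ (n * ((m:ℝ) + 2)) ≤ (∑' j : ℕ, ψ (((n+1:ℕ):ℝ) + j)) / n := by
  have hn' : (1:ℝ) ≤ n := by exact_mod_cast hn
  have hs := psi_summable0 h (by omega : 1 ≤ n+1)
  have hnn := (seq2_psi h (by omega : 1 ≤ n+1)).nn
  have pos : ∀ m : ℕ, 0 ≤ ψ (n * ((m:ℝ) + 2)) := fun m => (h.1 _ (by nlinarith [m.cast_nonneg (α := ℝ)])).le
  have key : ∀ M : ℕ, ∑ m ∈ Finset.range M, ψ (n * ((m:ℝ) + 2)) ≤ (∑ j ∈ Finset.range (n*M), ψ (((n+1:ℕ):ℝ) + j))/n := by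
    intro M
    induction M with
    | zero => simp
    | succ M ih =>
      rw [Finset.sum_range_succ, Nat.mul_succ, Finset.sum_range_add, add_div]
      refine add_le_add ih ?_
      rw [le_div_iff₀ (by positivity)]
      have : ∑ x ∈ Finset.range n, ψ (n * ((M:ℝ) + 2)) ≤ ∑ x ∈ Finset.range n, ψ (((n+1:ℕ):ℝ) + (n*M + x : ℕ)) := by
        refine Finset.sum_le_sum fun x hx => ?_
        have hx : x + 1 ≤ n := Finset.mem_range.1 hx
        have hx' : (x:ℝ) + 1 ≤ n := by exact_mod_cast hx
        have M0 := M.cast_nonneg (α := ℝ)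
        have x0 := x.cast_nonneg (α := ℝ)
        have nM : 0 ≤ (n:ℝ) * M := by positivity
        refine psi_anti h (Set.mem_Ici.2 ?_) (Set.mem_Ici.2 ?_) ?_
        · push_cast; linarith
        · nlinarith
        · push_cast; linarith
      simp only [Finset.sum_const, Finset.card_range, nsmul_eq_mul] at this
      linarith
  have key2 : ∀ M : ℕ, ∑ m ∈ Finset.range M, ψ (n * ((m:ℝ) + 2)) ≤ (∑' j : ℕ, ψ (((n+1:ℕ):ℝ) + j)) / n := fun M =>
    (key M).trans (div_le_div_of_nonneg_right (hs.sum_le_tsum _ fun i _ => hnn i) (by positivity))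
  exact ⟨summable_of_sum_range_le pos key2, Real.tsum_le_of_sum_range_le pos key2⟩

section
variable {φ : ℝ → ℝ} (hφ : PerL1 φ) (he : ∀ x, φ (-x) = φ x)

lemma sin_zero (he : ∀ x, φ (-x) = φ x) (k : ℝ) : ∫ x in (-π)..π, φ x * Real.sin (k*x) = 0 := by
  have := intervalIntegral.integral_comp_neg (a := -π) (b := π) (fun x => φ x * Real.sin (k*x))
  simp only [he, mul_neg, Real.sin_neg, neg_neg, intervalIntegral.integral_neg] at this
  linarith

lemma four_shift (hφ : PerL1 φ) (he : ∀ x, φ (-x) = φ x) (k c : ℝ) :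
    ∫ s in (-π)..π, φ s * Real.cos (k*s + c) = Real.cos c * ∫ s in (-π)..π, φ s * Real.cos (k*s) := by
  have hz := sin_zero he k
  have i1 : IntervalIntegrable (fun s => φ s * Real.cos (k*s)) volume (-π) π := hφ.1.mul_continuousOn (by fun_prop)
  have i2 : IntervalIntegrable (fun s => φ s * Real.sin (k*s)) volume (-π) π := hφ.1.mul_continuousOn (by fun_prop)
  have : ∀ s, φ s * Real.cos (k*s + c) = Real.cos c * (φ s * Real.cos (k*s)) - Real.sin c * (φ s * Real.sin (k*s)) := by
    intro s; rw [Real.cos_add]; ring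
  simp only [this]
  rw [intervalIntegral.integral_sub (i1.const_mul _) (i2.const_mul _), intervalIntegral.integral_const_mul,
    intervalIntegral.integral_const_mul, hz]; ring

lemma four_conv (hφ : PerL1 φ) (he : ∀ x, φ (-x) = φ x) (k : ℕ) (x c : ℝ) :
    ∫ t in (-π)..π, φ (x - t) * Real.cos (k*t - c) = Real.cos (k*x - c) * ∫ s in (-π)..π, φ s * Real.cos (k*s) := by
  have hp : Function.Periodic (fun s => φ s * Real.cos (k*(x - s) - c)) (2*π) := fun s => by
    beta_reduce
    rw [hφ.2, ← Real.cos_add_nat_mul_two_pi (k*(x - (s + 2*π)) - c) k]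
    congr 2; ring
  have := per_refl hp x
  simp only [sub_sub_cancel] at this
  rw [this]
  rw [← four_shift hφ he k (k*x - c)]
  have e : ∀ s, φ s * Real.cos (k*(x-s) - c) = φ (-s) * Real.cos (k*(-s) + (k*x - c)) := fun s => by
    rw [he]; congr 2; ring
  simp only [e]
  rw [intervalIntegral.integral_comp_neg (fun s => φ s * Real.cos (k*s + (k*x-c))), neg_neg]

lemma four_zero (hφ : PerL1 φ) (he : ∀ x, φ (-x) = φ x) {n : ℕ} (hn : 1 ≤ n) (ha : ∀ x, φ (x + π/n) = - φ x)
    (k : ℕ) (hk : ¬ n ∣ k) : ∫ s in (-π)..π, φ s * Real.cos (k*s) = 0 := by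
  have hn' : (1:ℝ) ≤ n := by exact_mod_cast hn
  have hp : Function.Periodic (fun s => φ s * Real.cos (k*s)) (2*π) := fun s => by
    beta_reduce
    rw [hφ.2, mul_add, Real.cos_add_nat_mul_two_pi]
  have h1 := per_shift hp (π/n)
  have e : ∀ s, φ (s + π/n) * Real.cos (k*(s+π/n)) = - (φ s * Real.cos (k*s + k*(π/n))) := fun s => by
    rw [ha, mul_add]; ring
  simp only [e, intervalIntegral.integral_neg] at h1
  rw [four_shift hφ he] at h1
  by_contra hne
  have hc : Real.cos (k*(π/n)) = -1 := by
    refine mul_right_cancel₀ hne ?_; linarith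
  have h2 : Real.cos (2*(k*(π/n))) = 1 := by rw [Real.cos_two_mul, hc]; norm_num
  obtain ⟨m, hm⟩ := (Real.cos_eq_one_iff _).1 h2
  have : (m:ℝ) * n = k := by
    have p0 := pi_pos
    field_simp at hm
    linarith
  have h3 : m * (n:ℤ) = k := by exact_mod_cast this
  exact hk (Int.natCast_dvd_natCast.1 ⟨m, by rw [← h3]; ring⟩)

lemma four_le (hφ : PerL1 φ) (k : ℕ) : |∫ s in (-π)..π, φ s * Real.cos (k*s)| ≤ norm1 φ := by
  have p0 := pi_pos
  refine (intervalIntegral.abs_integral_le_integral_abs (by linarith)).trans ?_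
  refine intervalIntegral.integral_mono_on (by linarith) ?_ hφ.1.abs fun x _ => ?_
  · exact (hφ.1.mul_continuousOn (by fun_prop)).abs
  · rw [abs_mul]; exact mul_le_of_le_one_right (abs_nonneg _) (Real.abs_cos_le_one _)

end

lemma conv_series {ψ η φ : ℝ → ℝ} (h : IsMInfPlus ψ η) (β : ℝ) (hφ : PerL1 φ) (he : ∀ x, φ (-x) = φ x) (x : ℝ) :
    HasSum (fun k : ℕ => ψ (k+1) * (Real.cos ((k+1:ℕ)*x - β*π/2) * ∫ s in (-π)..π, φ s * Real.cos ((k+1:ℕ)*s)))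
      (∫ t in (-π)..π, φ (x - t) * PsiKer ψ β t) := by
  have hs := psi_summable1 h
  have hx := hφ.refl_arg x
  have := intervalIntegral.hasSum_integral_of_dominated_convergence (a := -π) (b := π) (μ := volume)
    (F := fun (k:ℕ) t => φ (x - t) * (ψ (k+1) * Real.cos ((k+1)*t - β*π/2)))
    (f := fun t => φ (x-t) * PsiKer ψ β t) (fun k t => |φ (x-t)| * ψ (k+1)) ?_ ?_ ?_ ?_ ?_
  · have e : (fun k : ℕ => ψ (k+1) * (Real.cos ((k+1:ℕ)*x - β*π/2) * ∫ s in (-π)..π, φ s * Real.cos ((k+1:ℕ)*s)))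
        = fun k : ℕ => ∫ t in (-π)..π, φ (x - t) * (ψ (k+1) * Real.cos ((k+1)*t - β*π/2)) := by
      funext k
      rw [← four_conv hφ he, ← intervalIntegral.integral_const_mul]
      congr 1; ext t; push_cast; ring
    rw [e]; exact this
  · intro k
    exact (hx.aesm.mul (by fun_prop : Continuous fun t : ℝ => (ψ (k+1) * Real.cos ((k+1)*t - β*π/2))).aestronglyMeasurable).restrict
  · intro k
    refine Eventually.of_forall fun t _ => ?_
    rw [norm_mul, norm_mul, Real.norm_eq_abs, Real.norm_eq_abs, Real.norm_eq_abs, abs_of_pos (psi_pos' h k)]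
    exact mul_le_mul_of_nonneg_left (mul_le_of_le_one_right (psi_pos' h k).le (Real.abs_cos_le_one _)) (abs_nonneg _)
  · exact Eventually.of_forall fun t _ => hs.mul_left _
  · simp only [tsum_mul_left]
    exact hx.1.abs.mul_const _
  · exact Eventually.of_forall fun t _ => (PsiKer_summable h β t).hasSum.mul_left _

lemma conv_approx {ψ η φ : ℝ → ℝ} (h : IsMInfPlus ψ η) (β : ℝ) (hφ : PerL1 φ) (he : ∀ x, φ (-x) = φ x)
    {n : ℕ} (hn : 1 ≤ n) (ha : ∀ x, φ (x + π/n) = - φ x) (x : ℝ) :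
    |(∫ t in (-π)..π, φ (x - t) * PsiKer ψ β t) -
      ψ n * (∫ s in (-π)..π, φ s * Real.cos (n*s)) * Real.cos (n*x - β*π/2)| ≤
      norm1 φ * ((∑' j : ℕ, ψ (((n+1:ℕ):ℝ) + j)) / n) := by
  have hn' : (1:ℝ) ≤ n := by exact_mod_cast hn
  have hS := conv_series h β hφ he x
  obtain ⟨c, hc⟩ : ∃ c : ℕ → ℝ, ∀ k, c k = ψ k * (Real.cos (k*x - β*π/2) * ∫ s in (-π)..π, φ s * Real.cos (k*s)) :=
    ⟨_, fun _ => rfl⟩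
  have hS' : HasSum (fun k : ℕ => c (k+1)) (∫ t in (-π)..π, φ (x - t) * PsiKer ψ β t) := by
    convert hS using 2 with k; rw [hc]; push_cast; rfl
  have g_inj : Function.Injective (fun m : ℕ => n*(m+1) - 1) := by
    intro a b hab
    have h1 : 1 ≤ n*(a+1) := Nat.mul_pos (by omega) (by omega)
    have h2 : 1 ≤ n*(b+1) := Nat.mul_pos (by omega) (by omega)
    simp only at hab
    have : n*(a+1) = n*(b+1) := by omega
    have := Nat.eq_of_mul_eq_mul_left (by omega) this
    omega
  have hsup : Function.support (fun k : ℕ => c (k+1)) ⊆ Set.range (fun m : ℕ => n*(m+1) - 1) := by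
    intro k hk
    by_cases hd : n ∣ k+1
    · obtain ⟨q, hq⟩ := hd
      have : q ≠ 0 := by rintro rfl; simp at hq
      obtain ⟨m, rfl⟩ := Nat.exists_eq_succ_of_ne_zero this
      exact ⟨m, by simp only [← Nat.succ_eq_add_one]; omega⟩
    · refine absurd ?_ hk
      simp only [hc, four_zero hφ he hn ha (k+1) hd, mul_zero]
  have hg : ∀ m : ℕ, n*(m+1) - 1 + 1 = n*(m+1) := fun m => by
    have h1 : 1 ≤ n*(m+1) := Nat.mul_pos (by omega) (by omega)
    omega
  have e1 := g_inj.tsum_eq hsup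
  simp only [hg] at e1
  have hsum1 : Summable (fun m : ℕ => c (n*(m+1))) := by
    have := hS'.summable.comp_injective g_inj
    refine this.congr fun m => ?_
    show c (n*(m+1)-1+1) = _
    rw [hg]
  rw [hS'.tsum_eq, hsum1.tsum_eq_zero_add] at e1
  rw [← e1]
  obtain ⟨sp1, sp2⟩ := sparse_sum h hn
  have nb : ‖∑' m : ℕ, c (n*(m+1+1))‖ ≤ norm1 φ * ∑' m : ℕ, ψ (n * ((m:ℝ) + 2)) := by
    refine tsum_of_norm_bounded (sp1.hasSum.mul_left _) fun m => ?_
    have pp : 0 < ψ (n * ((m:ℝ)+2)) := h.1 _ (by nlinarith [m.cast_nonneg (α := ℝ)])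
    rw [hc, show (((n*(m+1+1):ℕ)):ℝ) = n * ((m:ℝ)+2) by push_cast; ring, Real.norm_eq_abs, abs_mul, abs_mul, abs_of_pos pp]
    have f := four_le hφ (n*(m+1+1))
    rw [show (((n*(m+1+1):ℕ)):ℝ) = n * ((m:ℝ)+2) by push_cast; ring] at f
    rw [mul_comm (norm1 φ)]
    refine mul_le_mul_of_nonneg_left ?_ pp.le
    calc _ ≤ 1 * norm1 φ := mul_le_mul (Real.abs_cos_le_one _) f (abs_nonneg _) zero_le_one
      _ = _ := one_mul _
  have e0 : c (n * (0+1)) = ψ n * (∫ s in (-π)..π, φ s * Real.cos (n*s)) * Real.cos (n*x - β*π/2) := by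
    rw [hc]; simp; ring
  rw [e0, add_sub_cancel_left]
  exact nb.trans (mul_le_mul_of_nonneg_left sp2 (norm1_nonneg _))

lemma dexist {ω : ℝ → ℝ} (hω : GoodMod ω) (hcv : ConcaveOn ℝ (Set.Ici 0) ω) {ε : ℝ} (hε : 0 < ε) :
    ∃ d : ℝ → ℝ, Continuous d ∧ (∀ u, 0 ≤ d u) ∧ AntitoneOn d (Set.Ici 0) ∧
      (∀ u, 0 ≤ u → 2 * ∫ v in (0:ℝ)..u, d v ≤ ω (2*u)) ∧
      (∀ u, 0 ≤ u → ω (2*u) - ω ε ≤ 2 * ∫ v in (0:ℝ)..u, d v) := by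
  obtain ⟨hc, hm, hsub, h0, hnn⟩ := hω
  have ii : ∀ a b, IntervalIntegrable ω volume a b := fun a b => hc.intervalIntegrable a b
  have key : ∀ u, 2 * ∫ v in (0:ℝ)..u, (ω (2*v+ε) - ω (2*v))/ε = ((∫ s in (0:ℝ)..ε, ω (2*u+s)) - ∫ s in (0:ℝ)..ε, ω s)/ε := by
    intro u
    rw [intervalIntegral.integral_div, intervalIntegral.integral_sub
      ((by fun_prop : Continuous fun v => ω (2*v+ε)).intervalIntegrable _ _)
      ((by fun_prop : Continuous fun v => ω (2*v)).intervalIntegrable _ _),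
      intervalIntegral.integral_comp_mul_add ω (by norm_num) ε, intervalIntegral.integral_comp_mul_left ω (by norm_num),
      intervalIntegral.integral_comp_add_left ω]
    simp only [mul_zero, zero_add, add_zero, smul_eq_mul]
    have q1 := intervalIntegral.integral_add_adjacent_intervals (ii 0 ε) (ii ε (2*u+ε))
    have q2 := intervalIntegral.integral_add_adjacent_intervals (ii 0 (2*u)) (ii (2*u) (2*u+ε))
    rw [← mul_div_assoc]
    congr 1
    linarith
  refine ⟨fun u => (ω (2*u+ε) - ω (2*u))/ε, by fun_prop, fun u => ?_, ?_, fun u hu => ?_, fun u hu => ?_⟩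
  · exact div_nonneg (sub_nonneg.2 (hm (by linarith))) hε.le
  · intro s hs t ht hst
    have hs : 0 ≤ s := hs
    have ht : 0 ≤ t := ht
    refine div_le_div_of_nonneg_right ?_ hε.le
    rcases hst.eq_or_lt with rfl | hlt
    · exact le_rfl
    have hL : 0 < 2*t + ε - 2*s := by linarith
    have m1 : 2*s ∈ Set.Ici (0:ℝ) := Set.mem_Ici.2 (by linarith)
    have m2 : 2*t+ε ∈ Set.Ici (0:ℝ) := Set.mem_Ici.2 (by linarith)
    have w1 : 0 ≤ ε / (2*t+ε-2*s) := by positivity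
    have w2 : 0 ≤ (2*t-2*s) / (2*t+ε-2*s) := div_nonneg (by linarith) hL.le
    have w3 : (2*t-2*s) / (2*t+ε-2*s) + ε / (2*t+ε-2*s) = 1 := by rw [← add_div, div_eq_one_iff_eq hL.ne']; ring
    have c1 := hcv.2 m1 m2 w2 w1 w3
    have c2 := hcv.2 m1 m2 w1 w2 (by rw [add_comm]; exact w3)
    simp only [smul_eq_mul] at c1 c2
    rw [show (2*t-2*s) / (2*t+ε-2*s) * (2*s) + ε / (2*t+ε-2*s) * (2*t+ε) = 2*s+ε by field_simp; ring] at c1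
    rw [show ε / (2*t+ε-2*s) * (2*s) + (2*t-2*s) / (2*t+ε-2*s) * (2*t+ε) = 2*t by field_simp; ring] at c2
    have e : ((2*t-2*s) / (2*t+ε-2*s)) = 1 - ε / (2*t+ε-2*s) := by linarith
    rw [e] at c1 c2
    linarith
  · rw [key, div_le_iff₀ hε]
    have : ∫ s in (0:ℝ)..ε, ω (2*u+s) ≤ ∫ s in (0:ℝ)..ε, (ω (2*u) + ω s) := by
      refine intervalIntegral.integral_mono_on hε.le ?_ ?_ fun s hs => hsub _ _ (by linarith) hs.1
      · exact (by fun_prop : Continuous _).intervalIntegrable _ _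
      · exact (by fun_prop : Continuous _).intervalIntegrable _ _
    rw [intervalIntegral.integral_add (by simp) (ii _ _)] at this
    simp only [intervalIntegral.integral_const, smul_eq_mul, sub_zero] at this
    linarith
  · rw [key, le_div_iff₀ hε]
    have a1 : ∫ s in (0:ℝ)..ε, ω (2*u) ≤ ∫ s in (0:ℝ)..ε, ω (2*u+s) := by
      refine intervalIntegral.integral_mono_on hε.le (by simp) ?_ fun s hs => hm (by linarith [hs.1])
      exact (by fun_prop : Continuous _).intervalIntegrable _ _
    have a2 : ∫ s in (0:ℝ)..ε, ω s ≤ ∫ s in (0:ℝ)..ε, ω ε :=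
      intervalIntegral.integral_mono_on hε.le (ii _ _) (by simp) fun s hs => hm hs.2
    simp only [intervalIntegral.integral_const, smul_eq_mul, sub_zero] at a1 a2
    linarith

lemma An_lower {ω d : ℝ → ℝ} (hω : GoodMod ω) {n : ℕ} (hn : 1 ≤ n) (hd : Continuous d) {δ : ℝ}
    (h2 : ∀ u, 0 ≤ u → ω (2*u) - δ ≤ 2 * ∫ v in (0:ℝ)..u, d v) :
    (eN n ω - δ)/2 ≤ ∫ u in (0:ℝ)..(π/(2*n)), d u * Real.cos (n*u) := by
  have hn' : (1:ℝ) ≤ n := by exact_mod_cast hn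
  have p0 := pi_pos
  have hb : 0 ≤ π/(2*n) := by positivity
  have hDd : ∀ x, HasDerivAt (fun u => ∫ v in (0:ℝ)..u, d v) (d x) x := fun x =>
    intervalIntegral.integral_hasDerivAt_right (hd.intervalIntegrable _ _) (hd.stronglyMeasurableAtFilter _ _) hd.continuousAt
  have hDc : Continuous (fun u => ∫ v in (0:ℝ)..u, d v) :=
    continuous_iff_continuousAt.2 fun x => (hDd x).continuousAt
  have hcd : ∀ x : ℝ, HasDerivAt (fun u : ℝ => Real.cos (n*u)) (-(n * Real.sin (n*x))) x := fun x => by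
    have := ((hasDerivAt_id x).const_mul (n:ℝ)).cos
    rw [show -(n * Real.sin (n*x)) = -Real.sin (n * x) * (n*1) by ring]
    exact this
  have parts := intervalIntegral.integral_mul_deriv_eq_deriv_mul (a := 0) (b := π/(2*n))
    (fun x _ => hcd x) (fun x _ => hDd x)
    ((by fun_prop : Continuous fun x : ℝ => -(n * Real.sin (n*x))).intervalIntegrable _ _) (hd.intervalIntegrable _ _)
  rw [show (n:ℝ) * (π/(2*n)) = π/2 by field_simp, Real.cos_pi_div_two, intervalIntegral.integral_same] at parts
  have e1 : ∫ u in (0:ℝ)..(π/(2*n)), d u * Real.cos (n*u) = ∫ u in (0:ℝ)..(π/(2*n)), n * ((∫ v in (0:ℝ)..u, d v) * Real.sin (n*u)) := by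
    rw [show (∫ u in (0:ℝ)..(π/(2*n)), d u * Real.cos (n*u)) = ∫ u in (0:ℝ)..(π/(2*n)), Real.cos (n*u) * d u by
      congr 1; ext; ring, parts]
    rw [zero_mul, mul_zero, sub_zero, zero_sub, ← intervalIntegral.integral_neg]
    congr 1; ext; ring
  rw [e1]
  have hωc := hω.1
  have sc := eN_scale n hn ω
  have is : ∫ u in (0:ℝ)..(π/(2*n)), Real.sin (n*u) = 1/n := by
    rw [intervalIntegral.integral_comp_mul_left (fun x => Real.sin x) (by positivity), integral_sin,
      show (n:ℝ) * (π/(2*n)) = π/2 by field_simp]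
    simp
  have e2 : ∫ u in (0:ℝ)..(π/(2*n)), n * ((ω (2*u) - δ)/2 * Real.sin (n*u)) = (eN n ω - δ)/2 := by
    have : ∀ u : ℝ, n * ((ω (2*u) - δ)/2 * Real.sin (n*u)) = (n/2) * (ω (2*u) * Real.sin (n*u)) - (n/2*δ) * Real.sin (n*u) :=
      fun u => by ring
    simp only [this]
    rw [intervalIntegral.integral_sub ((by fun_prop : Continuous _).intervalIntegrable _ _)
      ((by fun_prop : Continuous _).intervalIntegrable _ _), intervalIntegral.integral_const_mul,
      intervalIntegral.integral_const_mul, sc, is]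
    field_simp
  rw [← e2]
  refine intervalIntegral.integral_mono_on hb ((by fun_prop : Continuous _).intervalIntegrable _ _)
      ((by fun_prop : Continuous _).intervalIntegrable _ _) fun u hu => ?_
  have hs : 0 ≤ Real.sin (n*u) := Real.sin_nonneg_of_nonneg_of_le_pi (mul_nonneg (by positivity) hu.1) (by
    calc (n:ℝ) * u ≤ n * (π/(2*n)) := mul_le_mul_of_nonneg_left hu.2 (by positivity)
      _ = π/2 := by field_simp
      _ ≤ π := by linarith)
  have := h2 u hu.1
  refine mul_le_mul_of_nonneg_left (mul_le_mul_of_nonneg_right (by linarith) hs) (by positivity)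

lemma lower {ψ η ω : ℝ → ℝ} (h : IsMInfPlus ψ η) (β : ℝ) {n : ℕ} (hn : 1 ≤ n)
    (hω : GoodMod ω) (hcv : ConcaveOn ℝ (Set.Ici 0) ω) {ε : ℝ} (hε : 0 < ε) :
    ∃ φ, PerL1 φ ∧ (∫ x in (-π)..π, φ x) = 0 ∧
      (∀ t, 0 ≤ t → ∀ h, |h| ≤ t → ∫ x in (-π)..π, |φ (x + h) - φ x| ≤ ω t) ∧
      ∀ T, IsTrigPoly n T → 2 * ψ n * (eN n ω - ω ε) - 5 * π * ω (1/n) * ((∑' j : ℕ, ψ (((n+1:ℕ):ℝ) + j)) / n) ≤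
        ∫ x in (-π)..π, |(∫ t in (-π)..π, φ (x - t) * PsiKer ψ β t) - T x| := by
  have hn' : (1:ℝ) ≤ n := by exact_mod_cast hn
  have p0 := pi_pos
  obtain ⟨d, hd, hd0, hda, hd1, hd2⟩ := dexist hω hcv hε
  obtain ⟨φ, hφ, he, ha, hnorm, hA, hmod⟩ := extremal hd (fun u _ => hd0 u) hda hn
  have hb : 0 ≤ π/(2*n) := by positivity
  have hnle : 2 * norm1 φ ≤ ω (π/n) := by
    rw [hnorm]
    refine (hd1 _ hb).trans (le_of_eq ?_)
    congr 1; field_simp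
  have hW : ∀ t, 0 ≤ t → ∫ x in (-π)..π, |φ (x + t) - φ x| ≤ ω t := by
    intro t ht
    rcases le_total t (π/n) with h1 | h1
    · refine (hmod t ht h1).trans ((hd1 (t/2) (by linarith)).trans (le_of_eq ?_))
      congr 1; ring
    · refine le_trans ?_ (hnle.trans (hω.2.1 h1))
      have : ∫ x in (-π)..π, |φ (x + t) - φ x| ≤ ∫ x in (-π)..π, (|φ (x + t)| + |φ x|) := by
        refine intervalIntegral.integral_mono_on (by linarith) ((hφ.add_arg t).1.sub hφ.1).abs
          ((hφ.add_arg t).1.abs.add hφ.1.abs) fun x _ => abs_sub _ _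
      rw [intervalIntegral.integral_add (hφ.add_arg t).1.abs hφ.1.abs, hφ.norm_shift] at this
      unfold norm1 at *
      linarith
  have hA0 := An_lower hω hn hd hd2
  rw [← hA] at hA0
  have hAn : 0 ≤ ∫ x in (-π)..π, φ x * Real.cos (n*x) := by
    rw [hA]
    refine intervalIntegral.integral_nonneg hb fun u hu => mul_nonneg (hd0 u) ?_
    refine Real.cos_nonneg_of_neg_pi_div_two_le_of_le ?_ ?_
    · have : 0 ≤ (n:ℝ) * u := mul_nonneg (by positivity) hu.1
      linarith [pi_pos]
    · calc (n:ℝ) * u ≤ n * (π/(2*n)) := mul_le_mul_of_nonneg_left hu.2 (by positivity)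
        _ = π/2 := by field_simp
  refine ⟨φ, hφ, ?_, ?_, ?_⟩
  · have := per_shift hφ.2 (π/n)
    simp only [ha, intervalIntegral.integral_neg] at this
    linarith
  · intro t ht s hs
    have := neg_shift hφ hW (-s)
    rw [abs_neg] at this
    refine le_trans (le_of_eq ?_) (this.trans (hω.2.1 hs))
    congr 1; ext x; rw [abs_sub_comm, sub_neg_eq_add]
  · intro T hT
    obtain ⟨A, hAA⟩ : ∃ A, A = ∫ x in (-π)..π, φ x * Real.cos (n*x) := ⟨_, rfl⟩
    obtain ⟨f0, hf0⟩ : ∃ f0 : ℝ → ℝ, ∀ x, f0 x = ∫ t in (-π)..π, φ (x - t) * PsiKer ψ β t := ⟨_, fun _ => rfl⟩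
    obtain ⟨S, hS⟩ : ∃ S, S = (∑' j : ℕ, ψ (((n+1:ℕ):ℝ) + j)) / n := ⟨_, rfl⟩
    have S0 : 0 ≤ S := by
      rw [hS]; exact div_nonneg (tsum_nonneg (seq2_psi h (by omega : 1 ≤ n+1)).nn) (by positivity)
    have hψ : 0 < ψ n := h.1 _ hn'
    have hap := conv_approx h β hφ he hn ha
    have hfi := (young hφ (PsiKer_cont h β) (show -π ≤ π by linarith)).1
    simp only [← hf0, ← hAA, ← hS] at hap hfi hAn hA0 ⊢
    have cb := cos_best hn hT (mul_nonneg hψ.le hAn) (β*π/2)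
    have hTi := hT.perL1.1
    have hci : IntervalIntegrable (fun x : ℝ => ψ n * A * Real.cos (n*x - β*π/2)) volume (-π) π :=
      (by fun_prop : Continuous _).intervalIntegrable _ _
    have le1 : ∫ x in (-π)..π, |ψ n * A * Real.cos (n*x - β*π/2) - T x| ≤
        ∫ x in (-π)..π, (|f0 x - T x| + norm1 φ * S) := by
      refine intervalIntegral.integral_mono_on (by linarith) (hci.sub hTi).abs ((hfi.sub hTi).abs.add (by simp)) fun x _ => ?_
      have := hap x
      rw [abs_sub_comm] at this
      have t := abs_add_le (ψ n * A * Real.cos (n*x - β*π/2) - f0 x) (f0 x - T x)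
      rw [sub_add_sub_cancel] at t
      linarith
    rw [intervalIntegral.integral_add (hfi.sub hTi).abs (by simp)] at le1
    simp only [intervalIntegral.integral_const, smul_eq_mul] at le1
    have w := omega_pi hn hω
    have q : norm1 φ * S ≤ 5/2 * ω (1/n) * S := mul_le_mul_of_nonneg_right (by linarith) S0
    have q2 : ψ n * ((eN n ω - ω ε)/2) ≤ ψ n * A := mul_le_mul_of_nonneg_left hA0 hψ.le
    have q3 : 2 * π * (norm1 φ * S) ≤ 2 * π * (5/2 * ω (1/n) * S) := mul_le_mul_of_nonneg_left q (by positivity)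
    linarith

lemma errQ_le {ψ η : ℝ → ℝ} (h : IsMInfPlus ψ η) {n : ℕ} (hn : 1 ≤ n) (hm : 2 < (n:ℝ) / (η n - n)) :
    errQ ψ η n ≤ 8 * gammaN ψ η n ∧ (∑' j : ℕ, ψ (((n+1:ℕ):ℝ) + j)) / n ≤ errQ ψ η n := by
  have hn' : (1:ℝ) ≤ n := by exact_mod_cast hn
  have heta := (h.2.2.2.2.1 n hn').1
  have hx : 0 < η n - n := by linarith
  have b := psi_sum_bound h hn (N := n+1) (by omega) hm.le
  have ps : 0 < ψ ((n:ℝ)+1) := h.1 _ (by linarith)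
  have p3 : 0 < ψ (3*n) := h.1 _ (by linarith)
  have L0 : 0 ≤ ψ (3*n) * (1 + max 0 (Real.log (η n - n))) := by positivity
  refine ⟨?_, by unfold errQ; linarith⟩
  unfold errQ gammaN
  have h1 : (η n - n)/n ≤ 1/((n:ℝ) / (η n - n) - 2) := by
    rw [show (η n - n)/n = 1/((n:ℝ) / (η n - n)) by field_simp]
    exact one_div_le_one_div_of_le (by linarith) (by linarith)
  have h2 : (∑' j : ℕ, ψ (((n+1:ℕ):ℝ) + j)) / n ≤ ψ (n+1) * (8 * (1/n + 1/((n:ℝ) / (η n - n) - 2))) := by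
    have a1 : (((n+1:ℕ):ℝ))/n ≤ 2 := by rw [div_le_iff₀ (by positivity)]; push_cast; linarith
    have a2 : (∑' j : ℕ, ψ (((n+1:ℕ):ℝ) + j)) ≤ ψ (n+1) * (1 + 8 * (η n - n)) := by
      refine b.trans ?_
      push_cast at a1 ⊢
      refine mul_le_mul_of_nonneg_left ?_ ps.le
      nlinarith
    calc _ ≤ (ψ (n+1) * (1 + 8 * (η n - n)))/n := div_le_div_of_nonneg_right a2 (by positivity)
      _ = ψ (n+1) * (1/n + 8 * ((η n - n)/n)) := by ring
      _ ≤ _ := by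
        refine mul_le_mul_of_nonneg_left ?_ ps.le
        have : 0 ≤ 1/(n:ℝ) := by positivity
        linarith
  linarith

lemma goodmod {ω : ℝ → ℝ} (h : IsModulus ω) (hcv : ConcaveOn ℝ (Set.Ici 0) ω) :
    ∃ w : ℝ → ℝ, (∀ t, 0 ≤ t → w t = ω t) ∧ GoodMod w ∧ ConcaveOn ℝ (Set.Ici 0) w := by
  obtain ⟨hc, hm, hs, h0, hnn⟩ := h
  have e : ∀ t, 0 ≤ t → ω (max t 0) = ω t := fun t ht => by rw [max_eq_left ht]
  refine ⟨fun t => ω (max t 0), e, ⟨?_, ?_, ?_, ?_, ?_⟩, ?_⟩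
  · exact hc.comp_continuous (by fun_prop) fun t => Set.mem_Ici.2 (le_max_right _ _)
  · exact fun a b hab => hm (Set.mem_Ici.2 (le_max_right _ _)) (Set.mem_Ici.2 (le_max_right _ _)) (max_le_max_right _ hab)
  · intro s t h1 h2
    simp only [e _ h1, e _ h2, e _ (add_nonneg h1 h2)]
    exact hs s t h1 h2
  · simp [h0]
  · exact fun t => hnn _ (le_max_right _ _)
  · exact hcv.congr fun t ht => (e t ht).symm

lemma EnL1_le {n : ℕ} {f T : ℝ → ℝ} (hT : IsTrigPoly n T) : EnL1 n f ≤ ∫ x in (-π)..π, |f x - T x| := by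
  refine csInf_le ⟨0, ?_⟩ ⟨T, hT, rfl⟩
  rintro e ⟨S, -, rfl⟩
  exact norm1_nonneg (fun x => f x - S x)

lemma le_EnL1 {n : ℕ} {f : ℝ → ℝ} {c : ℝ} (h : ∀ T, IsTrigPoly n T → c ≤ ∫ x in (-π)..π, |f x - T x|) : c ≤ EnL1 n f := by
  refine le_csInf ⟨_, _, IsTrigPoly.zero, rfl⟩ ?_
  rintro e ⟨S, hS, rfl⟩
  exact h S hS

lemma main_upper {ψ η ω w : ℝ → ℝ} (h : IsMInfPlus ψ η) (β : ℝ) {n : ℕ} (hn : 1 ≤ n)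
    (hm : 2 < (n:ℝ) / (η n - n)) (hw : GoodMod w) (hww : ∀ t, 0 ≤ t → w t = ω t) {f : ℝ → ℝ}
    (hf : f ∈ L1Class ψ β ω) :
    EnL1 n f ≤ (1/π) * (2 * ψ n * eN n w + 10000 * errQ ψ η n * w (1/n)) := by
  have p0 := pi_pos
  obtain ⟨-, -, a, φ, hi, hp, -, hmod, hae⟩ := hf
  have hφ : PerL1 φ := ⟨hi, hp⟩
  obtain ⟨-, T, hT, hle⟩ := upper h β hn hm.le hw hφ (fun t ht => by
    rw [hww t ht]; exact hmod t ht t (abs_of_nonneg ht).le)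
  have hT' := (IsTrigPoly.const hn (a/2)).add (hT.cmul (1/π))
  refine (EnL1_le hT').trans ?_
  have e : ∫ x in (-π)..π, |f x - (a/2 + 1/π * T x)| =
      (1/π) * ∫ x in (-π)..π, |(∫ t in (-π)..π, φ (x - t) * PsiKer ψ β t) - T x| := by
    rw [← intervalIntegral.integral_const_mul]
    refine intervalIntegral.integral_congr_ae ?_
    filter_upwards [hae] with x hx _
    rw [hx, add_sub_add_left_eq_sub, ← mul_sub, abs_mul, abs_of_pos (by positivity : 0 < 1/π)]
  rw [e]
  exact mul_le_mul_of_nonneg_left hle (by positivity)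

lemma main_lower {ψ η ω w : ℝ → ℝ} (h : IsMInfPlus ψ η) (β : ℝ) {n : ℕ} (hn : 1 ≤ n)
    (hw : GoodMod w) (hcv : ConcaveOn ℝ (Set.Ici 0) w) (hww : ∀ t, 0 ≤ t → w t = ω t) {ε : ℝ} (hε : 0 < ε) :
    ∃ f ∈ L1Class ψ β ω, (1/π) * (2 * ψ n * (eN n w - w ε) -
      5 * π * w (1/n) * ((∑' j : ℕ, ψ (((n+1:ℕ):ℝ) + j)) / n)) ≤ EnL1 n f := by
  have p0 := pi_pos
  obtain ⟨φ, hφ, hint, hmod, hT⟩ := lower h β hn hw hcv hε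
  refine ⟨fun x => (1/π) * ∫ t in (-π)..π, φ (x - t) * PsiKer ψ β t, ⟨?_, ?_, 0, φ, hφ.1, hφ.2, hint, ?_, ?_⟩, ?_⟩
  · exact (young hφ (PsiKer_cont h β) (show -π ≤ π by linarith)).1.const_mul _
  · intro x
    have : ∀ t, φ (x + 2*π - t) = φ (x - t) := fun t => by rw [← hφ.2 (x - t)]; congr 1; ring
    simp only [this]
  · intro t ht s hs
    rw [← hww t ht]; exact hmod t ht s hs
  · exact Eventually.of_forall fun x => by simp
  · refine le_EnL1 fun T hTT => ?_
    have := hT _ (hTT.cmul π)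
    have e : ∫ x in (-π)..π, |(1/π) * (∫ t in (-π)..π, φ (x - t) * PsiKer ψ β t) - T x| =
      (1/π) * ∫ x in (-π)..π, |(∫ t in (-π)..π, φ (x - t) * PsiKer ψ β t) - π * T x| := by
      rw [← intervalIntegral.integral_const_mul]
      refine intervalIntegral.integral_congr fun x _ => ?_
      beta_reduce
      rw [← abs_of_pos (by positivity : 0 < 1/π), ← abs_mul, abs_of_pos (by positivity : 0 < 1/π)]
      congr 1; field_simp
    rw [e]
    exact mul_le_mul_of_nonneg_left this (by positivity)

theorem statement2 :
    ∃ K : ℝ, 0 < K ∧ ∀ ψ η : ℝ → ℝ, IsMInfPlus ψ η → ∀ β : ℝ, ∀ ω : ℝ → ℝ,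
      IsModulus ω → ConcaveOn ℝ (Set.Ici 0) ω → ∀ n : ℕ,
      2 < (n : ℝ) / (η n - n) →
      |EnL1Class n (L1Class ψ β ω) - (2 / π) * ψ n * eN n ω| ≤
        K * gammaN ψ η n * ω (1 / n) := by
  refine ⟨80000, by norm_num, fun ψ η h β ω hω hcv n hm => ?_⟩
  have hn : 1 ≤ n := by
    rcases Nat.eq_zero_or_pos n with rfl | h0
    · simp at hm; linarith
    · exact h0
  have hn' : (1:ℝ) ≤ n := by exact_mod_cast hn
  have p0 := pi_pos
  obtain ⟨w, hww, hw, hwc⟩ := goodmod hω hcv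
  have ee : eN n ω = eN n w := by
    unfold eN
    refine intervalIntegral.integral_congr fun t ht => ?_
    rw [Set.uIcc_of_le (by positivity)] at ht
    beta_reduce
    rw [hww _ (by have := ht.1; positivity)]
  have ew : ω (1/n) = w (1/n) := (hww _ (by positivity)).symm
  rw [ee, ew]
  obtain ⟨q1, q2⟩ := errQ_le h hn hm
  obtain ⟨S, hS⟩ : ∃ S, S = (∑' j : ℕ, ψ (((n+1:ℕ):ℝ) + j)) / n := ⟨_, rfl⟩
  have S0 : 0 ≤ S := by
    rw [hS]; exact div_nonneg (tsum_nonneg (seq2_psi h (by omega : 1 ≤ n+1)).nn) (by positivity)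
  rw [← hS] at q2
  have W0 := hw.2.2.2.2 (1/n)
  have hbdd : BddAbove (EnL1 n '' L1Class ψ β ω) := by
    refine ⟨(1/π) * (2 * ψ n * eN n w + 10000 * errQ ψ η n * w (1/n)), ?_⟩
    · rintro _ ⟨f, hf, rfl⟩
      exact main_upper h β hn hm hw hww hf
  have hup : EnL1Class n (L1Class ψ β ω) ≤ (1/π) * (2 * ψ n * eN n w + 10000 * errQ ψ η n * w (1/n)) := by
    obtain ⟨f, hf, -⟩ := main_lower h β hn hw hwc hww one_pos
    refine csSup_le ⟨_, f, hf, rfl⟩ ?_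
    rintro _ ⟨f, hf, rfl⟩
    exact main_upper h β hn hm hw hww hf
  have hlow : (1/π) * (2 * ψ n * eN n w - 5 * π * w (1/n) * S) ≤ EnL1Class n (L1Class ψ β ω) := by
    have hall : ∀ ε, 0 < ε → (1/π) * (2 * ψ n * (eN n w - w ε) - 5 * π * w (1/n) * S) ≤ EnL1Class n (L1Class ψ β ω) := by
      intro ε hε
      obtain ⟨f, hf, hle⟩ := main_lower h β hn hw hwc hww hε
      rw [hS]
      exact hle.trans (le_csSup hbdd ⟨f, hf, rfl⟩)
    have hwcont := hw.1
    have lim : Tendsto (fun ε => (1/π) * (2 * ψ n * (eN n w - w ε) - 5 * π * w (1/n) * S)) (nhdsWithin 0 (Set.Ioi 0))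
        (nhds ((1/π) * (2 * ψ n * (eN n w - w 0) - 5 * π * w (1/n) * S))) :=
      ((by fun_prop : Continuous (fun ε => (1/π) * (2 * ψ n * (eN n w - w ε) - 5 * π * w (1/n) * S))).tendsto 0).mono_left
        nhdsWithin_le_nhds
    rw [hw.2.2.2.1, sub_zero] at lim
    exact le_of_tendsto lim (eventually_nhdsWithin_of_forall fun ε hε => hall ε hε)
  have inv : 1/π ≤ 1 := by rw [div_le_one p0]; linarith [Real.pi_gt_three]
  have Q0 : 0 ≤ errQ ψ η n := S0.trans q2
  have c1 : (1/π) * (10000 * errQ ψ η n * w (1/n)) ≤ 80000 * gammaN ψ η n * w (1/n) := by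
    calc (1/π) * (10000 * errQ ψ η n * w (1/n)) ≤ 1 * (10000 * errQ ψ η n * w (1/n)) :=
          mul_le_mul_of_nonneg_right inv (by positivity)
      _ = 10000 * (errQ ψ η n * w (1/n)) := by ring
      _ ≤ 10000 * ((8 * gammaN ψ η n) * w (1/n)) := by gcongr
      _ = _ := by ring
  have c2 : 5 * w (1/n) * S ≤ 80000 * gammaN ψ η n * w (1/n) := by
    calc 5 * w (1/n) * S ≤ 10000 * w (1/n) * (8 * gammaN ψ η n) := by
          refine mul_le_mul ?_ (q2.trans q1) S0 (by positivity)
          linarith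
      _ = _ := by ring
  have e1 : (1/π) * (2 * ψ n * eN n w - 5 * π * w (1/n) * S) = (2/π) * ψ n * eN n w - 5 * w (1/n) * S := by
    field_simp
  have e2 : (1/π) * (2 * ψ n * eN n w + 10000 * errQ ψ η n * w (1/n)) = (2/π) * ψ n * eN n w +
      (1/π) * (10000 * errQ ψ η n * w (1/n)) := by ring
  rw [abs_le]
  constructor <;> linarith
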